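/- arXiv:0711.0676 — 3 statements merged into one kernel-verified Lean document; each statement's English description precedes it below -/
import Mathlib

section
/- Let 0 < p < ∞ with p not an even integer. Let E ⊂ 𝕋 be a 0-symmetric measurable set with |E| > 0, let ε > 0, and let M ∈ ℕ. Then there exists a positive definite trigonometric polynomial f, all gaps between consecutive frequencies of whose spectrum are at least M, such that ∫_{𝕋∖E} |f|^p ≤ ε · ∫_𝕋 |f|^p. -/
open MeasureTheory Finset

namespace PosDefConcentration

open Filter Topology ComplexConjugate

local notation "𝕋" => AddCircle (1 : ℝ)

lemma volume_eq_haarAddCircle : (volume : Measure 𝕋) = AddCircle.haarAddCircle := by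
  simp [AddCircle.volume_eq_smul_haarAddCircle]

lemma norm_fourier_apply (n : ℤ) (x : 𝕋) : ‖fourier n x‖ = 1 := by
  rw [fourier_apply, Circle.norm_coe]

lemma fourier_natCast_mul_smul (n : ℤ) (N : ℕ) (x : 𝕋) :
    fourier n (N • x) = fourier (N * n) x := by
  rw [fourier_apply, fourier_apply, ← natCast_zsmul, smul_smul, mul_comm]

lemma integral_fourier (n : ℤ) : ∫ x : 𝕋, fourier n x = if n = 0 then 1 else 0 := by
  have h := fourierCoeff_fourier (T := (1 : ℝ)) n
  have h0 := congrFun h 0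
  rw [fourierCoeff, ← volume_eq_haarAddCircle] at h0
  simp only [neg_zero, fourier_zero, one_smul] at h0
  rw [h0, Pi.single_apply]
  simp [eq_comm]

lemma integrable_of_bounded {E : Type*} [NormedAddCommGroup E] {W : 𝕋 → E}
    (hW : AEStronglyMeasurable W volume) {C : ℝ} (hC : ∀ x, ‖W x‖ ≤ C) : Integrable W :=
  Integrable.of_bound hW C (Eventually.of_forall hC)

lemma norm_integral_le_of_bounded {E : Type*} [NormedAddCommGroup E] [NormedSpace ℝ E]
    {F : 𝕋 → E} {C : ℝ} (hC : ∀ x, ‖F x‖ ≤ C) : ‖∫ x, F x‖ ≤ C := by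
  have := norm_integral_le_of_norm_le_const (μ := volume) (Eventually.of_forall hC)
  rwa [measureReal_def, UnitAddCircle.measure_univ, ENNReal.toReal_one, mul_one] at this

/-- **Riemann–Lebesgue lemma** for bounded functions on the circle. -/
lemma tendsto_integral_mul_fourier {W : 𝕋 → ℂ} (hW : Measurable W) {C : ℝ}
    (hC : ∀ x, ‖W x‖ ≤ C) :
    Tendsto (fun n : ℤ => ∫ x, W x * fourier n x) cofinite (𝓝 0) := by
  have hL : MemLp W 2 (AddCircle.haarAddCircle (T := 1)) :=
    MemLp.of_bound hW.aestronglyMeasurable C (Eventually.of_forall hC)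
  have hs := (hasSum_sq_fourierCoeff hL.toLp).summable.tendsto_cofinite_zero
  have hs' : Tendsto (fun n : ℤ => fourierCoeff W n) cofinite (𝓝 0) := by
    have := hs.sqrt
    simp only [Real.sqrt_sq (norm_nonneg _), Real.sqrt_zero] at this
    rw [tendsto_zero_iff_norm_tendsto_zero]
    refine this.congr fun n => ?_
    rw [fourierCoeff_congr_ae hL.coeFn_toLp]
  have hneg : Tendsto (fun n : ℤ => -n) cofinite cofinite := neg_injective.tendsto_cofinite
  refine (hs'.comp hneg).congr fun n => ?_
  simp [fourierCoeff, volume_eq_haarAddCircle, mul_comm]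

/-- Equidistribution of `(x, N x)` on the two-dimensional torus, tested against a bounded weight. -/
lemma tendsto_integral_mul_comp_smul {W : 𝕋 → ℂ} (hW : Measurable W) {C : ℝ}
    (hC : ∀ x, ‖W x‖ ≤ C) (h : C(UnitAddTorus (Fin 2), ℂ)) :
    Tendsto (fun N : ℕ => ∫ x : 𝕋, W x * h ![x, N • x]) atTop
      (𝓝 (∫ x : 𝕋, W x * ∫ y : 𝕋, h ![x, y])) := by
  have hC0 : 0 ≤ C := (norm_nonneg _).trans (hC 0)
  have hbd (g : C(UnitAddTorus (Fin 2), ℂ)) (x y : 𝕋) : ‖g ![x, y]‖ ≤ ‖g‖ :=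
    g.norm_coe_le_norm _
  have hcy (g : C(UnitAddTorus (Fin 2), ℂ)) (x : 𝕋) : Continuous fun y : 𝕋 => g ![x, y] := by
    fun_prop
  have hiy (g : C(UnitAddTorus (Fin 2), ℂ)) (x : 𝕋) : Integrable fun y : 𝕋 => g ![x, y] :=
    integrable_of_bounded (hcy g x).aestronglyMeasurable (hbd g x)
  have hcx (g : C(UnitAddTorus (Fin 2), ℂ)) : Continuous fun x : 𝕋 => ∫ y : 𝕋, g ![x, y] := by
    have : Continuous (Function.uncurry fun (x y : 𝕋) => g ![x, y]) := by
      simp only [Function.uncurry_def]; fun_prop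
    simpa using continuous_parametric_integral_of_continuous (μ := volume) this isCompact_univ
  have hbx (g : C(UnitAddTorus (Fin 2), ℂ)) (x : 𝕋) : ‖∫ y : 𝕋, g ![x, y]‖ ≤ ‖g‖ :=
    norm_integral_le_of_bounded (hbd g x)
  have hi1 (g : C(UnitAddTorus (Fin 2), ℂ)) : Integrable fun x : 𝕋 => W x * ∫ y : 𝕋, g ![x, y] :=
    integrable_of_bounded (hW.aestronglyMeasurable.mul (hcx g).aestronglyMeasurable)
      (C := C * ‖g‖) fun x => by
        rw [norm_mul]; exact mul_le_mul (hC x) (hbx g x) (norm_nonneg _) hC0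
  have hi2 (g : C(UnitAddTorus (Fin 2), ℂ)) (N : ℕ) :
      Integrable fun x : 𝕋 => W x * g ![x, N • x] :=
    integrable_of_bounded (hW.aestronglyMeasurable.mul
      (by fun_prop : Continuous fun x : 𝕋 => g ![x, N • x]).aestronglyMeasurable)
      (C := C * ‖g‖) fun x => by
        rw [norm_mul]; exact mul_le_mul (hC x) (hbd g x _) (norm_nonneg _) hC0
  have hmem : h ∈ closure (Submodule.span ℂ (Set.range (UnitAddTorus.mFourier (d := Fin 2))) :
      Set C(UnitAddTorus (Fin 2), ℂ)) := by
    rw [← Submodule.topologicalClosure_coe, UnitAddTorus.span_mFourier_closure_eq_top]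
    trivial
  have hspan : ∀ g ∈ Submodule.span ℂ (Set.range (UnitAddTorus.mFourier (d := Fin 2))),
      Tendsto (fun N : ℕ => ∫ x : 𝕋, W x * g ![x, N • x]) atTop
        (𝓝 (∫ x : 𝕋, W x * ∫ y : 𝕋, g ![x, y])) := by
    intro g hg
    induction hg using Submodule.span_induction with
    | zero => simp
    | add f g _ _ hf hg =>
      have := hf.add hg
      rw [← integral_add (hi1 f) (hi1 g)] at this
      refine (this.congr fun N => ?_).trans (le_of_eq ?_)
      · rw [← integral_add (hi2 f N) (hi2 g N)]
        simp [mul_add]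
      · refine congrArg 𝓝 (integral_congr_ae (Eventually.of_forall fun x => ?_))
        simp only [ContinuousMap.add_apply]
        rw [integral_add (hiy f x) (hiy g x), mul_add]
    | smul a g _ hg =>
      refine ((hg.const_mul a).congr fun N => ?_).trans (le_of_eq ?_)
      · rw [← integral_const_mul]
        refine integral_congr_ae (Eventually.of_forall fun x => ?_)
        simp only [ContinuousMap.smul_apply, smul_eq_mul]; ring
      · rw [← integral_const_mul]
        refine congrArg 𝓝 (integral_congr_ae (Eventually.of_forall fun x => ?_))
        simp only [ContinuousMap.smul_apply, smul_eq_mul, integral_const_mul]; ring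
    | mem g hg =>
      obtain ⟨n, rfl⟩ := hg
      simp only [UnitAddTorus.mFourier, ContinuousMap.coe_mk, Fin.prod_univ_two,
        Matrix.cons_val_zero, Matrix.cons_val_one, integral_const_mul, integral_fourier]
      by_cases hn : n 1 = 0
      · simp [hn]
      · simp only [hn, if_false, mul_zero, integral_zero]
        have hinj : Function.Injective fun N : ℕ => n 0 + N * n 1 := by
          intro a b hab
          simpa [hn] using hab
        refine ((tendsto_integral_mul_fourier hW hC).comp
          (hinj.tendsto_cofinite.mono_left Nat.cofinite_eq_atTop.ge)).congr fun N => ?_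
        simp only [Function.comp, fourier_add, fourier_natCast_mul_smul]
  rw [Metric.tendsto_atTop]
  intro ε hε
  obtain ⟨g, hg, hgh⟩ := Metric.mem_closure_iff.1 hmem (ε / (3 * (C + 1))) (by positivity)
  obtain ⟨N₀, hN₀⟩ := Metric.tendsto_atTop.1 (hspan g hg) (ε / 3) (by positivity)
  have hsmall : C * ‖h - g‖ < ε / 3 := by
    rw [dist_eq_norm, lt_div_iff₀ (by positivity)] at hgh
    nlinarith [norm_nonneg (h - g)]
  refine ⟨N₀, fun N hN => ?_⟩
  have h1 : ‖(∫ x : 𝕋, W x * h ![x, N • x]) - ∫ x : 𝕋, W x * g ![x, N • x]‖ ≤ C * ‖h - g‖ := by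
    rw [← integral_sub (hi2 h N) (hi2 g N)]
    refine norm_integral_le_of_bounded fun x => ?_
    rw [← mul_sub, norm_mul]
    exact mul_le_mul (hC x) (hbd (h - g) x (N • x)) (norm_nonneg _) hC0
  have h2 : ‖(∫ x : 𝕋, W x * ∫ y : 𝕋, g ![x, y]) - ∫ x : 𝕋, W x * ∫ y : 𝕋, h ![x, y]‖
      ≤ C * ‖h - g‖ := by
    rw [norm_sub_rev, ← integral_sub (hi1 h) (hi1 g)]
    refine norm_integral_le_of_bounded fun x => ?_
    rw [← mul_sub, norm_mul, ← integral_sub (hiy h x) (hiy g x)]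
    exact mul_le_mul (hC x) (hbx (h - g) x) (norm_nonneg _) hC0
  have h3 := hN₀ N hN
  rw [dist_eq_norm] at h3 ⊢
  calc _ = ‖((∫ x : 𝕋, W x * h ![x, N • x]) - ∫ x : 𝕋, W x * g ![x, N • x])
        + ((∫ x : 𝕋, W x * g ![x, N • x]) - ∫ x : 𝕋, W x * ∫ y : 𝕋, g ![x, y])
        + ((∫ x : 𝕋, W x * ∫ y : 𝕋, g ![x, y]) - ∫ x : 𝕋, W x * ∫ y : 𝕋, h ![x, y])‖ := by
        congr 1; ring
    _ < ε := by
      refine (norm_add₃_le).trans_lt ?_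
      linarith

/-- `f` is a positive definite trigonometric polynomial with spectrum `H`, and `H` has gaps at
least `M`. -/
def IsPosDefGap (M : ℕ) (H : Finset ℤ) (f : 𝕋 → ℂ) : Prop :=
  H.Nonempty ∧ (∀ k₁ ∈ H, ∀ k₂ ∈ H, k₁ ≠ k₂ → (M : ℤ) ≤ |k₁ - k₂|) ∧
    ∃ c : ℤ → ℝ, (∀ k ∈ H, 0 < c k) ∧ ∀ x, f x = ∑ k ∈ H, (c k : ℂ) * fourier k x

lemma IsPosDefGap.continuous {M : ℕ} {H : Finset ℤ} {f : 𝕋 → ℂ} (hf : IsPosDefGap M H f) :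
    Continuous f := by
  obtain ⟨-, -, c, -, h⟩ := hf
  rw [funext h]
  fun_prop

lemma isPosDefGap_one (M : ℕ) : IsPosDefGap M {0} fun _ => 1 := by
  refine ⟨singleton_nonempty 0, ?_, fun _ => 1, by simp, by simp⟩
  intro k₁ h₁ k₂ h₂ hne
  simp only [mem_singleton] at h₁ h₂
  exact absurd (h₁.trans h₂.symm) hne

lemma IsPosDefGap.add {M : ℕ} {H K : Finset ℤ} {f g : 𝕋 → ℂ} (hf : IsPosDefGap M H f)
    (hg : IsPosDefGap M K g) (hHK : ∀ k ∈ H, ∀ l ∈ K, (M : ℤ) + 1 ≤ l - k) :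
    IsPosDefGap M (H ∪ K) fun x => f x + g x := by
  obtain ⟨hH, hfg, c, hc, hfc⟩ := hf
  obtain ⟨hK, hgg, d, hd, hgd⟩ := hg
  have hdisj : Disjoint H K := by
    rw [Finset.disjoint_left]
    intro k hk hk'
    have := hHK k hk k hk'
    omega
  refine ⟨hH.mono subset_union_left, ?_, fun k => if k ∈ H then c k else d k, ?_, ?_⟩
  · intro k₁ h₁ k₂ h₂ hne
    rw [mem_union] at h₁ h₂
    rcases h₁ with h₁ | h₁ <;> rcases h₂ with h₂ | h₂
    · exact hfg k₁ h₁ k₂ h₂ hne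
    · have := hHK k₁ h₁ k₂ h₂
      have := neg_le_abs (k₁ - k₂)
      omega
    · have := hHK k₂ h₂ k₁ h₁
      have := le_abs_self (k₁ - k₂)
      omega
    · exact hgg k₁ h₁ k₂ h₂ hne
  · intro k hk
    dsimp only
    split_ifs with h
    · exact hc k h
    · exact hd k ((mem_union.1 hk).resolve_left h)
  · intro x
    simp only [sum_union hdisj, hfc, hgd]
    congr 1
    · exact sum_congr rfl fun k hk => by simp [hk]
    · exact sum_congr rfl fun k hk => by simp [Finset.disjoint_right.1 hdisj hk]

lemma IsPosDefGap.shift {M : ℕ} {H : Finset ℤ} {f : 𝕋 → ℂ} (hf : IsPosDefGap M H f)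
    {a : ℝ} (ha : 0 < a) (m : ℤ) :
    IsPosDefGap M (H.map (addRightEmbedding m)) fun x => a * fourier m x * f x := by
  obtain ⟨hH, hfg, c, hc, hfc⟩ := hf
  refine ⟨hH.map, ?_, fun k => a * c (k - m), ?_, ?_⟩
  · simp only [Finset.mem_map, addRightEmbedding_apply]
    rintro _ ⟨k₁, h₁, rfl⟩ _ ⟨k₂, h₂, rfl⟩ hne
    rw [add_sub_add_right_eq_sub]
    exact hfg k₁ h₁ k₂ h₂ fun h => hne (by rw [h])
  · simp only [Finset.mem_map, addRightEmbedding_apply]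
    rintro _ ⟨k, hk, rfl⟩
    simpa using mul_pos ha (hc k hk)
  · intro x
    simp only [sum_map, hfc, mul_sum]
    refine sum_congr rfl fun k _ => ?_
    simp only [addRightEmbedding_apply, add_sub_cancel_right, fourier_add, Complex.ofReal_mul]
    ring

lemma IsPosDefGap.eventually_mul {M : ℕ} {H : Finset ℤ} {f : 𝕋 → ℂ} (hf : IsPosDefGap M H f)
    {r s : ℝ} (hr : 0 < r) (hs : 0 < s) (q : ℕ) {n : ℕ} (hn : 2 ≤ n) :
    ∀ᶠ N : ℕ in atTop, ∃ K, IsPosDefGap M K fun x =>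
      f x * (1 + r * fourier 1 (N • x) + s * fourier q x * fourier n (N • x)) := by
  obtain ⟨B, hB⟩ : ∃ B : ℕ, ∀ k ∈ H, |k| ≤ (B : ℤ) :=
    ⟨H.sup Int.natAbs, fun k hk => by
      rw [Int.abs_eq_natAbs]
      exact_mod_cast Finset.le_sup (f := Int.natAbs) hk⟩
  filter_upwards [eventually_ge_atTop (2 * B + M + 1)] with N hN
  have hnN : 2 * N ≤ n * N := Nat.mul_le_mul_right N hn
  zify at hN hnN
  have key := (hf.add (hf.shift hr N) ?_).add (hf.shift hs (q + N * n)) ?_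
  · refine Exists.intro _ ((congrArg (IsPosDefGap M _) (funext fun x => ?_)).mp key)
    simp only [fourier_natCast_mul_smul, fourier_add, mul_one]
    ring
  · simp only [Finset.mem_map, addRightEmbedding_apply]
    rintro k hk _ ⟨l, hl, rfl⟩
    have := abs_le.1 (hB k hk)
    have := abs_le.1 (hB l hl)
    lia
  · simp only [mem_union, Finset.mem_map, addRightEmbedding_apply]
    rintro _ (hk | ⟨k, hk, rfl⟩) _ ⟨l, hl, rfl⟩
    · have := abs_le.1 (hB _ hk)
      have := abs_le.1 (hB l hl)
      lia
    · have := abs_le.1 (hB k hk)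
      have := abs_le.1 (hB l hl)
      lia

/-- The `p`-th mean of `1 + r e₁ + z e_n` over the circle. -/
noncomputable def trinomialMean (p r : ℝ) (n : ℕ) (z : ℂ) : ℝ :=
  ∫ y : 𝕋, ‖1 + r * fourier 1 y + z * fourier n y‖ ^ p

lemma continuous_trinomialMean {p : ℝ} (hp : 0 < p) (r : ℝ) (n : ℕ) :
    Continuous (trinomialMean p r n) := by
  have : Continuous (Function.uncurry fun (z : ℂ) (y : 𝕋) =>
      ‖1 + r * fourier 1 y + z * fourier n y‖ ^ p) := by
    simp only [Function.uncurry_def]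
    exact Continuous.rpow_const (by fun_prop) fun _ => Or.inr hp.le
  simpa only [Measure.restrict_univ, ← trinomialMean.eq_def] using
    continuous_parametric_integral_of_continuous (μ := volume) this isCompact_univ

/-- A continuous function `u` is a *limit density* if, on passing from a weight `w ‖f‖ ^ p u` to
`w ‖g‖ ^ p`, negativity of the integral can be preserved by choosing a suitable positive definite
polynomial `g` with gaps at least `M`. -/
def IsLimitDensity (p : ℝ) (M : ℕ) (u : C(𝕋, ℝ)) : Prop :=
  ∀ (w : 𝕋 → ℝ) (C : ℝ) (H : Finset ℤ) (f : 𝕋 → ℂ), Measurable w → (∀ x, |w x| ≤ C) →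
    IsPosDefGap M H f → ∫ x, w x * ‖f x‖ ^ p * u x < 0 →
      ∃ K g, IsPosDefGap M K g ∧ ∫ x, w x * ‖g x‖ ^ p < 0

lemma continuous_norm_rpow {p : ℝ} (hp : 0 < p) {X : Type*} [TopologicalSpace X] {f : X → ℂ}
    (hf : Continuous f) : Continuous fun x => ‖f x‖ ^ p :=
  hf.norm.rpow_const fun _ => Or.inr hp.le

lemma exists_bound_mul {w u : 𝕋 → ℝ} {C : ℝ} (hw : ∀ x, |w x| ≤ C) (hu : Continuous u) :
    ∃ D, ∀ x, |w x * u x| ≤ D := by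
  obtain ⟨B, hB⟩ := isCompact_univ.exists_bound_of_continuousOn hu.continuousOn
  refine ⟨C * B, fun x => ?_⟩
  rw [abs_mul]
  exact mul_le_mul (hw x) (hB x trivial) (abs_nonneg _) ((abs_nonneg _).trans (hw x))

lemma integrable_mul {w u : 𝕋 → ℝ} {C : ℝ} (hwm : Measurable w) (hw : ∀ x, |w x| ≤ C)
    (hu : Continuous u) : Integrable fun x => w x * u x := by
  obtain ⟨D, hD⟩ := exists_bound_mul hw hu
  exact integrable_of_bounded (hwm.mul hu.measurable).aestronglyMeasurable hD

lemma isLimitDensity_trinomialMean {p : ℝ} (hp : 0 < p) (M : ℕ) {r s : ℝ} (hr : 0 < r)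
    (hs : 0 < s) (q : ℕ) {n : ℕ} (hn : 2 ≤ n) (u : C(𝕋, ℝ))
    (hu : ∀ x, u x = trinomialMean p r n (s * fourier q x)) : IsLimitDensity p M u := by
  intro w C H f hwm hw hf hneg
  obtain ⟨D, hD⟩ := exists_bound_mul hw (continuous_norm_rpow hp hf.continuous)
  have hWm : Measurable fun x => ((w x * ‖f x‖ ^ p : ℝ) : ℂ) :=
    Complex.measurable_ofReal.comp
      (hwm.mul (continuous_norm_rpow hp hf.continuous).measurable)
  let h : C(UnitAddTorus (Fin 2), ℂ) :=
    ⟨fun z => ((‖1 + r * fourier 1 (z 1) + s * fourier q (z 0) * fourier n (z 1)‖ ^ p : ℝ) : ℂ),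
      Complex.continuous_ofReal.comp (continuous_norm_rpow hp (by fun_prop))⟩
  have hlim := tendsto_integral_mul_comp_smul hWm (C := D) (fun x => by
    rw [Complex.norm_real]; exact hD x) h
  simp only [h, ContinuousMap.coe_mk, Matrix.cons_val_zero, Matrix.cons_val_one,
    integral_complex_ofReal, ← Complex.ofReal_mul] at hlim
  have hlim' := (Complex.continuous_re.tendsto _).comp hlim
  simp only [Function.comp_def, Complex.ofReal_re] at hlim'
  have hlt : (∫ x, w x * ‖f x‖ ^ p *
      ∫ y : 𝕋, ‖1 + r * fourier 1 y + s * fourier q x * fourier n y‖ ^ p) < 0 := by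
    simpa only [hu, trinomialMean] using hneg
  obtain ⟨N, hN, K, hK⟩ := ((hlim'.eventually (gt_mem_nhds hlt)).and
    (hf.eventually_mul hr hs q hn)).exists
  refine ⟨K, _, hK, ?_⟩
  simpa only [norm_mul, Real.mul_rpow (norm_nonneg _) (norm_nonneg _), mul_assoc] using hN

lemma IsLimitDensity.mul {p : ℝ} {M : ℕ} {u v : C(𝕋, ℝ)} (hu : IsLimitDensity p M u)
    (hv : IsLimitDensity p M v) : IsLimitDensity p M (u * v) := by
  intro w C H f hwm hw hf hneg
  obtain ⟨D, hD⟩ := exists_bound_mul hw v.continuous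
  obtain ⟨K, g, hg, hneg'⟩ := hu (fun x => w x * v x) D H f (hwm.mul v.continuous.measurable)
    hD hf (by
      refine lt_of_eq_of_lt (integral_congr_ae (Eventually.of_forall fun x => ?_)) hneg
      simp only [ContinuousMap.mul_apply]; ring)
  refine hv w C K g hwm hw hg (lt_of_eq_of_lt (integral_congr_ae
    (Eventually.of_forall fun x => ?_)) hneg')
  simp only; ring

lemma isLimitDensity_const {p : ℝ} (M : ℕ) {a : ℝ} (ha : 0 < a) :
    IsLimitDensity p M (ContinuousMap.const 𝕋 a) := by
  intro w C H f hwm hw hf hneg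
  refine ⟨H, f, hf, ?_⟩
  simp only [ContinuousMap.const_apply, integral_mul_const] at hneg
  exact neg_of_mul_neg_left hneg ha.le

lemma isClosed_isLimitDensity {p : ℝ} (hp : 0 < p) (M : ℕ) :
    IsClosed {u : C(𝕋, ℝ) | IsLimitDensity p M u} := by
  refine isClosed_of_closure_subset fun u hu w C H f hwm hw hf hneg => ?_
  have hfp := continuous_norm_rpow hp hf.continuous
  obtain ⟨D, hD⟩ := exists_bound_mul hw hfp
  have hD0 : 0 ≤ D := (abs_nonneg _).trans (hD 0)
  have hm : Measurable fun x => w x * ‖f x‖ ^ p := hwm.mul hfp.measurable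
  set I := ∫ x, w x * ‖f x‖ ^ p * u x with hI
  obtain ⟨v, hv, huv⟩ := Metric.mem_closure_iff.1 hu (-I / (D + 1))
    (div_pos (neg_pos.2 hneg) (by linarith))
  refine hv w C H f hwm hw hf ?_
  have hle : ‖∫ x, w x * ‖f x‖ ^ p * (v - u) x‖ ≤ D * ‖v - u‖ := by
    refine norm_integral_le_of_bounded fun x => ?_
    rw [norm_mul]
    exact mul_le_mul (hD x) ((v - u).norm_coe_le_norm x) (norm_nonneg _) hD0
  have hsplit : (∫ x, w x * ‖f x‖ ^ p * (v - u) x) = (∫ x, w x * ‖f x‖ ^ p * v x) - I := by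
    rw [hI, ← integral_sub (integrable_mul hm hD v.continuous) (integrable_mul hm hD u.continuous)]
    simp [mul_sub]
  rw [hsplit, Real.norm_eq_abs] at hle
  rw [dist_comm, dist_eq_norm, lt_div_iff₀ (by linarith)] at huv
  have := le_abs_self ((∫ x, w x * ‖f x‖ ^ p * v x) - I)
  nlinarith [norm_nonneg (v - u)]

lemma hasFDerivAt_norm_one_add_rpow (p : ℝ) :
    HasFDerivAt (fun z : ℂ => ‖1 + z‖ ^ p) (p • Complex.reCLM) 0 := by
  have h1 : HasFDerivAt (fun z : ℂ => 1 + z) (ContinuousLinearMap.id ℝ ℂ) 0 :=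
    (hasFDerivAt_id (𝕜 := ℝ) (0 : ℂ)).const_add 1
  have h2 := h1.norm_sq.rpow_const (p := p / 2) (Or.inl (by simp))
  have hfun : (fun z : ℂ => ‖1 + z‖ ^ p) = fun z : ℂ => (‖1 + z‖ ^ 2) ^ (p / 2) := by
    funext z
    rw [← Real.rpow_natCast, ← Real.rpow_mul (norm_nonneg _)]
    congr 1
    push_cast; ring
  rw [hfun]
  refine h2.congr_fderiv ?_
  ext z
  simp; ring

lemma half_le_norm_one_add {r : ℝ} (hr0 : 0 ≤ r) (hr : r ≤ 1 / 2) (y : 𝕋) :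
    1 / 2 ≤ ‖1 + r * fourier 1 y‖ ∧ ‖1 + r * fourier 1 y‖ ≤ 2 := by
  have h : ‖(r : ℂ) * fourier 1 y‖ = r := by
    rw [norm_mul, norm_fourier_apply, mul_one, Complex.norm_real, Real.norm_of_nonneg hr0]
  have h1 := norm_add_le (1 : ℂ) (r * fourier 1 y)
  have h2 := norm_sub_le (1 + r * fourier 1 y : ℂ) (r * fourier 1 y)
  rw [add_sub_cancel_right] at h2
  rw [h, norm_one] at h1 h2
  constructor <;> linarith

/-- The integral governing the first-order variation in `z` of `trinomialMean p r n z` at `0`. -/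
noncomputable def trinomialSlope (p r : ℝ) (n : ℕ) : ℂ :=
  ∫ y : 𝕋, (‖1 + r * fourier 1 y‖ ^ p : ℝ) / (1 + r * fourier 1 y) * fourier n y

lemma fourier_apply_neg (n : ℤ) (y : 𝕋) : fourier n (-y) = conj (fourier n y) := by
  rw [← fourier_neg, fourier_apply, fourier_apply, smul_neg, neg_smul]

lemma trinomialSlope_eq_re (p r : ℝ) (n : ℕ) :
    trinomialSlope p r n = ((trinomialSlope p r n).re : ℂ) := by
  refine (Complex.conj_eq_iff_re.1 ?_).symm
  rw [trinomialSlope, ← integral_conj, ← integral_neg_eq_self]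
  refine integral_congr_ae (Eventually.of_forall fun y => ?_)
  have hA : (1 + r * fourier 1 (-y) : ℂ) = conj (1 + r * fourier 1 y : ℂ) := by
    rw [fourier_apply_neg, map_add, map_mul, map_one, Complex.conj_ofReal]
  simp only
  rw [hA]
  simp only [Complex.norm_conj, map_mul, map_div₀, Complex.conj_ofReal, fourier_apply_neg,
    Complex.conj_conj]

lemma continuous_slope_integrand {p r : ℝ} (hp : 0 < p) (hr0 : 0 ≤ r) (hr : r ≤ 1 / 2) (n : ℕ) :
    Continuous fun y : 𝕋 =>
      ((‖1 + r * fourier 1 y‖ ^ p : ℝ) : ℂ) / (1 + r * fourier 1 y) * fourier n y := by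
  have h0 (y : 𝕋) : (1 + r * fourier 1 y : ℂ) ≠ 0 := by
    rw [← norm_pos_iff]
    linarith [(half_le_norm_one_add hr0 hr y).1]
  exact ((Complex.continuous_ofReal.comp (continuous_norm_rpow hp (by fun_prop))).div
    (by fun_prop) h0).mul (by fun_prop)

lemma integrable_of_continuous {E : Type*} [NormedAddCommGroup E] {F : 𝕋 → E}
    (hF : Continuous F) : Integrable F := by
  rw [← integrableOn_univ]
  exact hF.continuousOn.integrableOn_compact isCompact_univ

lemma hasFDerivAt_trinomialMean {p r : ℝ} (hp : 0 < p) (hr0 : 0 ≤ r) (hr : r ≤ 1 / 2) (n : ℕ) :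
    HasFDerivAt (trinomialMean p r n) ((p * (trinomialSlope p r n).re) • Complex.reCLM) 0 := by
  rw [hasFDerivAt_iff_isLittleO_nhds_zero, Asymptotics.isLittleO_iff]
  intro η hη
  have h := (hasFDerivAt_norm_one_add_rpow p)
  rw [hasFDerivAt_iff_isLittleO_nhds_zero, Asymptotics.isLittleO_iff] at h
  obtain ⟨δ, hδ, hδ'⟩ := Metric.eventually_nhds_iff.1 (h (c := η / (2 * 2 ^ p)) (by positivity))
  refine Metric.eventually_nhds_iff.2 ⟨δ / 2, by positivity, fun z hz => ?_⟩
  rw [dist_zero_right] at hz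
  simp only [zero_add, add_zero, norm_one, Real.one_rpow, smul_apply, Complex.reCLM_apply,
    smul_eq_mul, dist_zero_right] at hδ' ⊢
  have hS := continuous_slope_integrand hp hr0 hr n
  have hslope : p * (trinomialSlope p r n).re * z.re = ∫ y : 𝕋, p * (z *
      (((‖1 + r * fourier 1 y‖ ^ p : ℝ) : ℂ) / (1 + r * fourier 1 y) * fourier n y)).re := by
    rw [integral_const_mul]
    have := integral_re (𝕜 := ℂ) (integrable_of_continuous (hS.const_mul z))
    simp only [RCLike.re_to_complex] at this
    rw [this, integral_const_mul, ← trinomialSlope, trinomialSlope_eq_re, Complex.re_mul_ofReal,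
      Complex.ofReal_re]
    ring
  have hc1 : Continuous fun y : 𝕋 => ‖1 + r * fourier 1 y + z * fourier n y‖ ^ p :=
    continuous_norm_rpow hp (by fun_prop)
  have hc2 : Continuous fun y : 𝕋 => ‖1 + r * fourier 1 y + 0 * fourier n y‖ ^ p :=
    continuous_norm_rpow hp (by fun_prop)
  have hi : Integrable fun y : 𝕋 => ‖1 + r * fourier 1 y + z * fourier n y‖ ^ p -
      ‖1 + r * fourier 1 y + 0 * fourier n y‖ ^ p := integrable_of_continuous (hc1.sub hc2)
  have hi' : Integrable fun y : 𝕋 => p * (z *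
      (((‖1 + r * fourier 1 y‖ ^ p : ℝ) : ℂ) / (1 + r * fourier 1 y) * fourier n y)).re :=
    integrable_of_continuous ((Complex.continuous_re.comp (hS.const_mul z)).const_mul p)
  rw [hslope, trinomialMean, trinomialMean,
    ← integral_sub (integrable_of_continuous hc1) (integrable_of_continuous hc2),
    ← integral_sub hi hi']
  refine norm_integral_le_of_bounded fun y => ?_
  obtain ⟨hA1, hA2⟩ := half_le_norm_one_add hr0 hr y
  set A : ℂ := 1 + r * fourier 1 y
  have hA0 : A ≠ 0 := norm_pos_iff.1 (by linarith)
  set ζ : ℂ := z * fourier n y / A with hζ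
  have hζn : ‖ζ‖ ≤ 2 * ‖z‖ := by
    rw [hζ, norm_div, norm_mul, norm_fourier_apply, mul_one, div_le_iff₀ (by linarith)]
    nlinarith [norm_nonneg z]
  have hfac : ‖A + z * fourier n y‖ ^ p = ‖A‖ ^ p * ‖1 + ζ‖ ^ p := by
    rw [← Real.mul_rpow (norm_nonneg _) (norm_nonneg _), ← norm_mul, mul_add, mul_one, hζ,
      mul_div_cancel₀ _ hA0]
  have hre : (z * (((‖A‖ ^ p : ℝ) : ℂ) / A * fourier n y)).re = ‖A‖ ^ p * ζ.re := by
    rw [← Complex.re_ofReal_mul, hζ]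
    congr 1
    ring
  have hp2 : ‖A‖ ^ p ≤ 2 ^ p := Real.rpow_le_rpow (norm_nonneg _) hA2 hp.le
  rw [hfac, hre, zero_mul, add_zero]
  calc ‖‖A‖ ^ p * ‖1 + ζ‖ ^ p - ‖A‖ ^ p - p * (‖A‖ ^ p * ζ.re)‖
      = ‖A‖ ^ p * ‖‖1 + ζ‖ ^ p - 1 - p * ζ.re‖ := by
        rw [← Real.norm_of_nonneg (Real.rpow_nonneg (norm_nonneg A) p), ← norm_mul,
          Real.norm_of_nonneg (Real.rpow_nonneg (norm_nonneg A) p)]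
        congr 1; ring
    _ ≤ 2 ^ p * (η / (2 * 2 ^ p) * (2 * ‖z‖)) := by
        refine mul_le_mul hp2 ((hδ' (by linarith)).trans ?_) (norm_nonneg _) (by positivity)
        gcongr
    _ = η * ‖z‖ := by field_simp

lemma choose_succ_eq (a : ℝ) (n : ℕ) :
    Ring.choose a (n + 1) = Ring.choose a n * ((a - n) / (n + 1)) := by
  rw [Ring.choose_eq_smul, Ring.choose_eq_smul, descPochhammer_succ_right, Polynomial.smeval_mul,
    Nat.factorial_succ]
  simp only [Polynomial.smeval_sub, Polynomial.smeval_X, Polynomial.smeval_natCast, smul_eq_mul,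
    pow_one, pow_zero, nsmul_eq_mul, mul_one]
  push_cast
  have := Nat.factorial_ne_zero n
  field_simp

lemma exists_choose_sign {a : ℝ} (ha : ∀ m : ℕ, a ≠ m) :
    (∃ n, 2 ≤ n ∧ 0 < Ring.choose a n) ∧ ∃ n, 2 ≤ n ∧ Ring.choose a n < 0 := by
  have hne : ∀ n, Ring.choose a n ≠ 0 := by
    intro n
    induction n with
    | zero => simp
    | succ n ih =>
      rw [choose_succ_eq]
      exact mul_ne_zero ih (div_ne_zero (sub_ne_zero.2 (ha n)) (by positivity))
  obtain ⟨m, hm⟩ := exists_nat_gt a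
  have hneg : (a - (m + 2 : ℕ)) / ((m + 2 : ℕ) + 1) < 0 :=
    div_neg_of_neg_of_pos (by push_cast; linarith) (by positivity)
  have hs := choose_succ_eq a (m + 2)
  rcases lt_or_gt_of_ne (hne (m + 2)) with h | h
  · exact ⟨⟨m + 3, by omega, hs ▸ mul_pos_of_neg_of_neg h hneg⟩, m + 2, by omega, h⟩
  · exact ⟨⟨m + 2, by omega, h⟩, m + 3, by omega, hs ▸ mul_neg_of_pos_of_neg h hneg⟩

lemma norm_rpow_div_eq {p : ℝ} {z : ℂ} (hz : z ∈ Complex.slitPlane) :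
    ((‖z‖ ^ p : ℝ) : ℂ) / z = z ^ ((p / 2 - 1 : ℝ) : ℂ) * conj (z ^ ((p / 2 : ℝ) : ℂ)) := by
  have h0 := Complex.slitPlane_ne_zero hz
  have h1 : ((‖z‖ ^ p : ℝ) : ℂ) = z ^ ((p / 2 : ℝ) : ℂ) * conj (z ^ ((p / 2 : ℝ) : ℂ)) := by
    rw [Complex.mul_conj, Complex.normSq_eq_norm_sq, Complex.norm_cpow_real,
      ← Real.rpow_natCast, ← Real.rpow_mul (norm_nonneg _)]
    congr 2
    push_cast; ring
  rw [h1, Complex.ofReal_sub, Complex.ofReal_one, Complex.cpow_sub _ _ h0, Complex.cpow_one]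
  ring

/-- Partial sums of the binomial series. -/
noncomputable def binomialSum (a : ℝ) (n : ℕ) (z : ℂ) : ℂ :=
  ∑ i ∈ range n, (Ring.choose a i : ℝ) * z ^ i

lemma isBigO_one_add_cpow_sub (a : ℝ) (n : ℕ) :
    (fun z : ℂ => (1 + z) ^ (a : ℂ) - binomialSum a n z) =O[𝓝 0] fun z => ‖z‖ ^ n := by
  have := (Complex.one_add_cpow_hasFPowerSeriesAt_zero (a := (a : ℂ))).isBigO_sub_partialSum_pow n
  simpa [FormalMultilinearSeries.partialSum, binomialSum, binomialSeries, mul_comm,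
    FormalMultilinearSeries.coeff_ofScalars, Complex.ofReal_choose] using this

lemma isBigO_slope_integrand (p : ℝ) (n : ℕ) :
    (fun z : ℂ => ((‖1 + z‖ ^ p : ℝ) : ℂ) / (1 + z) -
      binomialSum (p / 2 - 1) n z * conj (binomialSum (p / 2) n z)) =O[𝓝 0] fun z => ‖z‖ ^ n := by
  have h1 := isBigO_one_add_cpow_sub (p / 2 - 1) n
  have h2 := isBigO_one_add_cpow_sub (p / 2) n
  have hT : (fun z : ℂ => binomialSum (p / 2 - 1) n z) =O[𝓝 0] fun _ => (1 : ℝ) := by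
    have : Continuous (binomialSum (p / 2 - 1) n) := by unfold binomialSum; fun_prop
    exact this.continuousAt.tendsto.isBigO_one ℝ
  have hh : (fun z : ℂ => conj ((1 + z) ^ ((p / 2 : ℝ) : ℂ))) =O[𝓝 0] fun _ => (1 : ℝ) := by
    have : ContinuousAt (fun z : ℂ => (1 + z) ^ ((p / 2 : ℝ) : ℂ)) 0 :=
      ContinuousAt.cpow (by fun_prop) continuousAt_const (by simp)
    exact (Complex.continuous_conj.continuousAt.comp this).tendsto.isBigO_one ℝ
  have h2' : (fun z : ℂ => conj ((1 + z) ^ ((p / 2 : ℝ) : ℂ) - binomialSum (p / 2) n z))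
      =O[𝓝 0] fun z => ‖z‖ ^ n := by
    refine Asymptotics.isBigO_norm_left.1 ?_
    simpa only [Complex.norm_conj] using h2.norm_left
  have h3 := h1.mul hh
  have h4 := hT.mul h2'
  simp only [mul_one, one_mul] at h3 h4
  have := h3.add h4
  refine this.congr' ?_ EventuallyEq.rfl
  have hs : ∀ᶠ z : ℂ in 𝓝 0, 1 + z ∈ Complex.slitPlane := by
    have : ContinuousAt (fun z : ℂ => 1 + z) 0 := by fun_prop
    exact this.eventually_mem (Complex.isOpen_slitPlane.mem_nhds (by simp))
  filter_upwards [hs] with z hz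
  rw [norm_rpow_div_eq hz, map_sub]
  ring

lemma integral_binomialSum_mul (a b r : ℝ) (n : ℕ) :
    ∫ y : 𝕋, binomialSum a (n + 1) (r * fourier 1 y) *
      conj (binomialSum b (n + 1) (r * fourier 1 y)) * fourier n y =
        (Ring.choose b n * r ^ n : ℝ) := by
  have hpow (i : ℕ) (y : 𝕋) : (fourier 1 y : ℂ) ^ i = fourier i y := by
    rw [fourier_apply, fourier_apply, one_smul, natCast_zsmul, AddCircle.toCircle_nsmul,
      Circle.coe_pow]
  have hexp (y : 𝕋) : binomialSum a (n + 1) (r * fourier 1 y) *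
      conj (binomialSum b (n + 1) (r * fourier 1 y)) * fourier n y =
      ∑ i ∈ range (n + 1), ∑ j ∈ range (n + 1),
        ((Ring.choose a i * Ring.choose b j * r ^ (i + j) : ℝ) : ℂ) *
          fourier (i - j + n : ℤ) y := by
    rw [binomialSum, binomialSum, map_sum, sum_mul_sum, sum_mul]
    refine sum_congr rfl fun i _ => ?_
    rw [sum_mul]
    refine sum_congr rfl fun j _ => ?_
    rw [fourier_add, sub_eq_add_neg, fourier_add, fourier_neg, mul_pow, mul_pow, hpow, hpow]
    simp only [map_mul, map_pow, Complex.conj_ofReal]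
    push_cast
    ring
  simp only [hexp]
  have hint (c : ℂ) (m : ℤ) : Integrable fun y : 𝕋 => c * fourier m y :=
    integrable_of_continuous (by fun_prop)
  rw [integral_finsetSum _ fun i _ => integrable_finsetSum _ fun j _ => hint _ _]
  simp only [integral_finsetSum _ fun j _ => hint _ _, integral_const_mul, integral_fourier]
  rw [sum_eq_single 0, sum_eq_single n]
  · simp
  · intro j _ hj
    rw [if_neg (by omega), mul_zero]
  · simp
  · intro i _ hi
    refine sum_eq_zero fun j hj => ?_
    rw [mem_range] at hj
    rw [if_neg (by omega), mul_zero]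
  · simp

lemma exists_trinomialSlope_sub_le {p : ℝ} (hp : 0 < p) (n : ℕ) :
    ∃ C : ℝ, ∃ δ > 0, ∀ r : ℝ, 0 < r → r < δ →
      |(trinomialSlope p r n).re - Ring.choose (p / 2) n * r ^ n| ≤ C * r ^ (n + 1) := by
  obtain ⟨C, hC⟩ := (isBigO_slope_integrand p (n + 1)).bound
  obtain ⟨δ, hδ, hδ'⟩ := Metric.eventually_nhds_iff.1 hC
  refine ⟨C, min δ (1 / 2), by positivity, fun r hr0 hr => ?_⟩
  have hr1 := hr.trans_le (min_le_left _ _)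
  have hr2 := hr.le.trans (min_le_right _ _)
  rw [← Real.norm_eq_abs, ← Complex.norm_real, Complex.ofReal_sub, ← trinomialSlope_eq_re,
    ← integral_binomialSum_mul (p / 2 - 1) (p / 2) r n, trinomialSlope, ← integral_sub]
  · refine norm_integral_le_of_bounded fun y => ?_
    have hn : ‖(r : ℂ) * fourier 1 y‖ = r := by
      rw [norm_mul, norm_fourier_apply, mul_one, Complex.norm_real, Real.norm_of_nonneg hr0.le]
    rw [← sub_mul, norm_mul, norm_fourier_apply, mul_one]
    have := hδ' (y := (r : ℂ) * fourier 1 y) (by rwa [dist_zero_right, hn])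
    rwa [hn, Real.norm_of_nonneg (by positivity)] at this
  · exact integrable_of_continuous (continuous_slope_integrand hp hr0.le hr2 n)
  · exact integrable_of_continuous (by unfold binomialSum; fun_prop)

/-- If `p` is not an even integer, the slope takes both signs. -/
lemma exists_trinomialSlope_sign {p : ℝ} (hp : 0 < p) (hpe : ∀ m : ℕ, p ≠ 2 * m) {a : ℝ}
    (ha : a ≠ 0) :
    ∃ n r, 2 ≤ n ∧ 0 < r ∧ r ≤ 1 / 2 ∧ 0 < a * (trinomialSlope p r n).re := by
  obtain ⟨n, hn, hb⟩ : ∃ n, 2 ≤ n ∧ 0 < a * Ring.choose (p / 2) n := by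
    obtain ⟨⟨n, hn, h⟩, m, hm, h'⟩ := exists_choose_sign (a := p / 2) fun m h => hpe m (by linarith)
    rcases lt_or_gt_of_ne ha with ha | ha
    · exact ⟨m, hm, mul_pos_of_neg_of_neg ha h'⟩
    · exact ⟨n, hn, mul_pos ha h⟩
  obtain ⟨C, δ, hδ, h⟩ := exists_trinomialSlope_sub_le hp n
  set b := Ring.choose (p / 2) n
  have hlim : ∀ᶠ r in 𝓝[>] (0 : ℝ), |a| * C * r < a * b := by
    have : ContinuousAt (fun r : ℝ => |a| * C * r) 0 := by fun_prop
    exact (this.eventually_lt continuousAt_const (by simpa using hb)).filter_mono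
      nhdsWithin_le_nhds
  have h1 : ∀ᶠ r in 𝓝[>] (0 : ℝ), r < min δ (1 / 2) :=
    (gt_mem_nhds (by positivity)).filter_mono nhdsWithin_le_nhds
  obtain ⟨r, ⟨hr1, hr2⟩, hr0⟩ := ((hlim.and h1).and self_mem_nhdsWithin).exists
  have hr0 : 0 < r := hr0
  refine ⟨n, r, hn, hr0, hr2.le.trans (min_le_right _ _), ?_⟩
  have h2 := h r hr0 (hr2.trans_le (min_le_left _ _))
  have h3 : |a * (trinomialSlope p r n).re - a * b * r ^ n| ≤ |a| * C * r * r ^ n := by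
    rw [mul_assoc a, ← mul_sub, abs_mul]
    refine (mul_le_mul_of_nonneg_left h2 (abs_nonneg a)).trans_eq ?_
    ring
  have h4 : |a| * C * r * r ^ n < a * b * r ^ n := mul_lt_mul_of_pos_right hr1 (by positivity)
  linarith [(abs_le.1 h3).1]

/-- Continuous functions whose exponential is a limit density. -/
def IsLogLimitDensity (p : ℝ) (M : ℕ) (v : C(𝕋, ℝ)) : Prop :=
  IsLimitDensity p M ((⟨Real.exp, Real.continuous_exp⟩ : C(ℝ, ℝ)).comp v)

lemma isClosed_isLogLimitDensity {p : ℝ} (hp : 0 < p) (M : ℕ) :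
    IsClosed {v : C(𝕋, ℝ) | IsLogLimitDensity p M v} :=
  (isClosed_isLimitDensity hp M).preimage (ContinuousMap.continuous_postcomp _)

lemma isLogLimitDensity_of_forall_exists {p : ℝ} (hp : 0 < p) {M : ℕ} {v : C(𝕋, ℝ)}
    (h : ∀ η > 0, ∃ v', IsLogLimitDensity p M v' ∧ ∀ x, |v x - v' x| ≤ η) :
    IsLogLimitDensity p M v := by
  refine (isClosed_isLogLimitDensity hp M).closure_subset (Metric.mem_closure_iff.2 fun η hη => ?_)
  obtain ⟨v', hv', hd⟩ := h (η / 2) (by positivity)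
  refine ⟨v', hv', lt_of_le_of_lt ?_ (half_lt_self hη)⟩
  exact (ContinuousMap.dist_le (by positivity)).2 hd

lemma IsLogLimitDensity.add {p : ℝ} {M : ℕ} {u v : C(𝕋, ℝ)} (hu : IsLogLimitDensity p M u)
    (hv : IsLogLimitDensity p M v) : IsLogLimitDensity p M (u + v) := by
  unfold IsLogLimitDensity
  convert IsLimitDensity.mul hu hv using 1
  ext x
  simp [Real.exp_add]

lemma isLogLimitDensity_const (p : ℝ) (M : ℕ) (a : ℝ) :
    IsLogLimitDensity p M (ContinuousMap.const 𝕋 a) := by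
  unfold IsLogLimitDensity
  exact isLimitDensity_const M (Real.exp_pos a)

lemma IsLogLimitDensity.nsmul {p : ℝ} {M : ℕ} {v : C(𝕋, ℝ)} (hv : IsLogLimitDensity p M v)
    (J : ℕ) : IsLogLimitDensity p M (J • v) := by
  induction J with
  | zero =>
    rw [zero_nsmul]
    exact isLogLimitDensity_const p M 0
  | succ J ih =>
    rw [succ_nsmul]
    exact ih.add hv

lemma trinomialMean_zero_pos {p r : ℝ} (hp : 0 < p) (hr0 : 0 ≤ r) (hr : r ≤ 1 / 2) (n : ℕ) :
    0 < trinomialMean p r n 0 := by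
  have hc : Continuous fun y : 𝕋 => ‖1 + r * fourier 1 y + 0 * fourier n y‖ ^ p :=
    continuous_norm_rpow hp (by fun_prop)
  have h : ∫ _ : 𝕋, (1 / 2 : ℝ) ^ p ≤ trinomialMean p r n 0 := by
    refine integral_mono (integrable_const _) (integrable_of_continuous hc) fun y => ?_
    simp only [zero_mul, add_zero]
    exact Real.rpow_le_rpow (by norm_num) (half_le_norm_one_add hr0 hr y).1 hp.le
  refine lt_of_lt_of_le ?_ h
  rw [integral_const, measureReal_def, UnitAddCircle.measure_univ]
  simp only [ENNReal.toReal_one, one_smul]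
  positivity

lemma isLogLimitDensity_cos {p : ℝ} (hp : 0 < p) (hpe : ∀ m : ℕ, p ≠ 2 * m) (M : ℕ) (a : ℝ)
    (q : ℕ) {v : C(𝕋, ℝ)} (hv : ∀ x, v x = a * (fourier q x : ℂ).re) :
    IsLogLimitDensity p M v := by
  rcases eq_or_ne a 0 with rfl | ha
  · convert isLogLimitDensity_const p M 0
    ext x
    simp [hv]
  obtain ⟨n, r, hn, hr0, hr, hsign⟩ := exists_trinomialSlope_sign hp hpe ha
  have hG0 := trinomialMean_zero_pos hp hr0.le hr n
  have hGc := continuous_trinomialMean hp r n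
  have hlog := (hasFDerivAt_trinomialMean hp hr0.le hr n).log hG0.ne'
  rw [smul_smul] at hlog
  set m := (trinomialMean p r n 0)⁻¹ * (p * (trinomialSlope p r n).re) with hm
  have ham : 0 < a / m := by
    have : 0 < a * m := by
      rw [hm, show a * ((trinomialMean p r n 0)⁻¹ * (p * (trinomialSlope p r n).re)) =
        (trinomialMean p r n 0)⁻¹ * (p * (a * (trinomialSlope p r n).re)) by ring]
      positivity
    have hm0 : m ≠ 0 := right_ne_zero_of_mul this.ne'
    rw [show a / m = a * m / m ^ 2 by field_simp]
    positivity
  have hm0 : m ≠ 0 := fun h => by simp [h] at ham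
  refine isLogLimitDensity_of_forall_exists hp fun η hη => ?_
  rw [hasFDerivAt_iff_isLittleO_nhds_zero, Asymptotics.isLittleO_iff] at hlog
  obtain ⟨δ, hδ, hδ'⟩ := Metric.eventually_nhds_iff.1
    ((hlog (c := η / (a / m)) (by positivity)).and
      (hGc.continuousAt.eventually (lt_mem_nhds hG0)))
  obtain ⟨J, hJ⟩ := exists_nat_gt (a / m / δ)
  have hJ0 : (0 : ℝ) < J := lt_trans (by positivity) hJ
  set s := a / m / J with hs
  have hs0 : 0 < s := by positivity
  have hsδ : s < δ := by
    rw [hs, div_lt_iff₀ hJ0]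
    rw [div_lt_iff₀ hδ] at hJ
    linarith
  have hnorm (x : 𝕋) : ‖(s : ℂ) * fourier q x‖ = s := by
    rw [norm_mul, norm_fourier_apply, mul_one, Complex.norm_real, Real.norm_of_nonneg hs0.le]
  have hnear (x : 𝕋) := hδ' (y := (s : ℂ) * fourier q x) (by rwa [dist_zero_right, hnorm])
  let u : C(𝕋, ℝ) := ⟨fun x => trinomialMean p r n (s * fourier q x), by fun_prop⟩
  let V : C(𝕋, ℝ) := ⟨fun x => Real.log (u x), u.continuous.log fun x => (hnear x).2.ne'⟩
  have hV : IsLogLimitDensity p M V := by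
    unfold IsLogLimitDensity
    convert isLimitDensity_trinomialMean hp M hr0 hs0 q hn u fun x => rfl using 1
    ext x
    exact Real.exp_log (hnear x).2
  refine ⟨J • (V + ContinuousMap.const 𝕋 (-Real.log (trinomialMean p r n 0))),
    (hV.add (isLogLimitDensity_const p M _)).nsmul J, fun x => ?_⟩
  have h := (hnear x).1
  simp only [zero_add, smul_apply, Complex.reCLM_apply, smul_eq_mul, hnorm,
    Complex.re_ofReal_mul] at h
  rw [hv, ContinuousMap.smul_apply, ContinuousMap.add_apply, ContinuousMap.const_apply,
    nsmul_eq_mul, abs_sub_comm]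
  have hVx : V x = Real.log (trinomialMean p r n (s * fourier q x)) := rfl
  have has : a = J * (m * s) := by rw [hs]; field_simp
  have heq : J * (V x + -Real.log (trinomialMean p r n 0)) - a * (fourier q x : ℂ).re =
      J * (Real.log (trinomialMean p r n (s * fourier q x)) - Real.log (trinomialMean p r n 0) -
        m * (s * (fourier q x : ℂ).re)) := by
    rw [hVx]
    conv_lhs => rw [has]
    ring
  rw [heq, abs_mul, abs_of_pos hJ0, ← Real.norm_eq_abs]
  refine (mul_le_mul_of_nonneg_left h hJ0.le).trans_eq ?_
  rw [show (J : ℝ) * (η / (a / m) * s) = η / (a / m) * (J * s) by ring, hs,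
    mul_div_cancel₀ _ hJ0.ne', div_mul_cancel₀ _ ham.ne']

/-- The real part of `a * (g x + g (-x))`. -/
noncomputable def symmRe (a : ℂ) (g : C(𝕋, ℂ)) : C(𝕋, ℝ) where
  toFun x := (a * (g x + g (-x))).re
  continuous_toFun := by fun_prop

lemma symmRe_apply (a : ℂ) (g : C(𝕋, ℂ)) (x : 𝕋) : symmRe a g x = (a * (g x + g (-x))).re := rfl

lemma fourier_natAbs_re (k : ℤ) (x : 𝕋) : (fourier k.natAbs x : ℂ).re = (fourier k x).re := by
  rcases Int.natAbs_eq k with h | h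
  · rw [← h]
  · conv_rhs => rw [h, fourier_neg, Complex.conj_re]

lemma isLogLimitDensity_symmRe {p : ℝ} (hp : 0 < p) (hpe : ∀ m : ℕ, p ≠ 2 * m) (M : ℕ)
    {g : C(𝕋, ℂ)} (hg : g ∈ Submodule.span ℂ (Set.range (fourier (T := 1)))) (a : ℂ) :
    IsLogLimitDensity p M (symmRe a g) := by
  induction hg using Submodule.span_induction generalizing a with
  | mem g hg =>
    obtain ⟨k, rfl⟩ := hg
    refine isLogLimitDensity_cos hp hpe M (2 * a.re) k.natAbs fun x => ?_
    rw [symmRe_apply, fourier_apply_neg, Complex.add_conj, fourier_natAbs_re, Complex.re_mul_ofReal]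
    ring
  | zero =>
    convert isLogLimitDensity_const p M 0
    ext x
    simp [symmRe_apply]
  | add g h _ _ hg hh =>
    convert (hg a).add (hh a) using 1
    refine ContinuousMap.ext fun x => ?_
    simp only [symmRe_apply, ContinuousMap.add_apply, ← Complex.add_re]
    congr 1
    ring
  | smul b g _ hg =>
    convert hg (a * b) using 1
    refine ContinuousMap.ext fun x => ?_
    simp only [symmRe_apply, ContinuousMap.smul_apply, smul_eq_mul]
    congr 1
    ring

lemma isLogLimitDensity_of_even {p : ℝ} (hp : 0 < p) (hpe : ∀ m : ℕ, p ≠ 2 * m) (M : ℕ)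
    {v : C(𝕋, ℝ)} (hv : ∀ x, v (-x) = v x) : IsLogLimitDensity p M v := by
  refine isLogLimitDensity_of_forall_exists hp fun η hη => ?_
  let g : C(𝕋, ℂ) := ⟨fun x => v x, by fun_prop⟩
  have hg : g ∈ (Submodule.span ℂ (Set.range (fourier (T := 1)))).topologicalClosure := by
    rw [span_fourier_closure_eq_top]
    trivial
  obtain ⟨h, hh, hd⟩ := Metric.mem_closure_iff.1 hg η hη
  refine ⟨symmRe (1 / 2) h, isLogLimitDensity_symmRe hp hpe M hh _, fun x => ?_⟩
  have hb (y : 𝕋) : ‖g y - h y‖ ≤ η := by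
    rw [← dist_eq_norm]
    exact (ContinuousMap.dist_apply_le_dist y).trans hd.le
  have heq : v x - symmRe (1 / 2) h x = (1 / 2 * ((g x - h x) + (g (-x) - h (-x)))).re := by
    have h1 : g x = v x := rfl
    have h2 : g (-x) = v x := by rw [← hv]; rfl
    have h3 : v x = (v x : ℂ).re := (Complex.ofReal_re _).symm
    rw [symmRe_apply, h1, h2, h3, ← Complex.sub_re, Complex.ofReal_re]
    congr 1
    ring
  rw [heq]
  refine (Complex.abs_re_le_norm _).trans ?_
  rw [norm_mul]
  have := norm_add_le (g x - h x) (g (-x) - h (-x))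
  have h12 : ‖(1 / 2 : ℂ)‖ = 1 / 2 := by simp
  rw [h12]
  linarith [hb x, hb (-x)]

lemma isLimitDensity_of_even {p : ℝ} (hp : 0 < p) (hpe : ∀ m : ℕ, p ≠ 2 * m) (M : ℕ)
    {u : C(𝕋, ℝ)} (hpos : ∀ x, 0 < u x) (hu : ∀ x, u (-x) = u x) : IsLimitDensity p M u := by
  let v : C(𝕋, ℝ) := ⟨fun x => Real.log (u x), u.continuous.log fun x => (hpos x).ne'⟩
  have hv : IsLogLimitDensity p M v :=
    isLogLimitDensity_of_even hp hpe M fun x => congrArg Real.log (hu x)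
  unfold IsLogLimitDensity at hv
  convert hv using 1
  ext x
  exact (Real.exp_log (hpos x)).symm

/-- If an even bounded weight has negative integral over some measurable set, then it has negative
integral against some even positive continuous function. -/
lemma exists_even_integral_neg {w : 𝕋 → ℝ} {C : ℝ} (hwm : Measurable w) (hw : ∀ x, |w x| ≤ C)
    (hws : ∀ x, w (-x) = w x) {E : Set 𝕋} (hEm : MeasurableSet E) (hneg : ∫ x in E, w x < 0) :
    ∃ u : C(𝕋, ℝ), (∀ x, 0 < u x) ∧ (∀ x, u (-x) = u x) ∧ ∫ x, w x * u x < 0 := by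
  have hC : 0 ≤ C := (abs_nonneg _).trans (hw 0)
  set I := ∫ x in E, w x with hIdef
  set η := -I / (2 * C + 1)
  have hη0 : 0 < η := div_pos (by linarith) (by linarith)
  have h1 : Integrable (E.indicator fun _ => (1 : ℝ)) :=
    (integrable_const (1 : ℝ)).indicator hEm
  obtain ⟨g, hg, -⟩ := h1.exists_boundedContinuous_integral_sub_le hη0
  let u : C(𝕋, ℝ) := ⟨fun x => (|g x| + |g (-x)|) / 2 + η, by fun_prop⟩
  have hux (x : 𝕋) : u x = (|g x| + |g (-x)|) / 2 + η := rfl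
  refine ⟨u, fun x => by rw [hux]; positivity, fun x => ?_, ?_⟩
  · rw [hux, hux, neg_neg, add_comm |g (-x)|]
  have hgc : Continuous fun x => |g x| := by fun_prop
  have hgc' : Continuous fun x => |g (-x)| := by fun_prop
  have hwg := integrable_mul hwm hw hgc
  have hwg' := integrable_mul hwm hw hgc'
  have hwi : Integrable w := integrable_of_bounded hwm.aestronglyMeasurable hw
  have hrefl : ∫ x, w x * |g (-x)| = ∫ x, w x * |g x| := by
    rw [← integral_neg_eq_self]
    simp only [neg_neg, hws]
  have hsplit : ∫ x, w x * u x = (∫ x, w x * |g x|) + (∫ x, w x) * η := by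
    have : ∀ x, w x * u x = (1 / 2) * (w x * |g x|) + (1 / 2) * (w x * |g (-x)|) + w x * η :=
      fun x => by rw [hux]; ring
    have hi : Integrable fun x => (1 / 2) * (w x * |g x|) + (1 / 2) * (w x * |g (-x)|) :=
      (hwg.const_mul _).add (hwg'.const_mul _)
    simp only [this]
    rw [integral_add hi (hwi.mul_const _),
      integral_add (hwg.const_mul _) (hwg'.const_mul _), integral_const_mul, integral_const_mul,
      hrefl, integral_mul_const]
    ring
  have hwle : ∫ x, w x ≤ C := (Real.le_norm_self _).trans (norm_integral_le_of_bounded hw)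
  have hI : I = ∫ x, w x * E.indicator (fun _ => (1 : ℝ)) x := by
    rw [hIdef, ← integral_indicator hEm]
    refine integral_congr_ae (Eventually.of_forall fun x => ?_)
    by_cases hx : x ∈ E <;> simp [hx]
  have hwE : Integrable fun x => w x * E.indicator (fun _ => (1 : ℝ)) x :=
    integrable_of_bounded (C := C) (hwm.mul (measurable_const.indicator hEm)).aestronglyMeasurable
      fun x => by by_cases hx : x ∈ E <;> simp [hx, hw x, hC]
  have hdiff : (∫ x, w x * |g x|) - I ≤ C * η := by
    rw [hI, ← integral_sub hwg hwE]
    refine le_trans ?_ (mul_le_mul_of_nonneg_left hg hC)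
    rw [← integral_const_mul]
    refine integral_mono (hwg.sub hwE) ?_ fun x => ?_
    · refine ((h1.sub ?_).norm).const_mul C
      exact integrable_of_continuous g.continuous
    · have h2 : |(|g x| - E.indicator (fun _ => (1 : ℝ)) x)| ≤
          ‖E.indicator (fun _ => (1 : ℝ)) x - g x‖ := by
        rw [Real.norm_eq_abs, abs_sub_comm _ (g x)]
        have h3 : E.indicator (fun _ => (1 : ℝ)) x = |E.indicator (fun _ => (1 : ℝ)) x| :=
          (abs_of_nonneg (Set.indicator_nonneg (fun _ _ => zero_le_one) x)).symm
        conv_lhs => rw [h3]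
        exact abs_abs_sub_abs_le _ _
      calc w x * |g x| - w x * E.indicator (fun _ => (1 : ℝ)) x
          ≤ |w x * (|g x| - E.indicator (fun _ => (1 : ℝ)) x)| := by
            rw [← mul_sub]
            exact le_abs_self _
        _ ≤ C * ‖E.indicator (fun _ => (1 : ℝ)) x - g x‖ := by
            rw [abs_mul]
            exact mul_le_mul (hw x) h2 (abs_nonneg _) hC
  have h4 : (∫ x, w x) * η ≤ C * η := mul_le_mul_of_nonneg_right hwle hη0.le
  have h5 : (2 * C + 1) * η = -I := mul_div_cancel₀ _ (by positivity)
  rw [hsplit]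
  linarith

end PosDefConcentration

/-- **Concentration of positive definite polynomials with large gaps**
(Bonami–Révész). For `0 < p` not an even integer, any `0`-symmetric measurable
`E ⊆ 𝕋` of positive measure, any `ε > 0` and any prescribed gap `M`, there is a
nonzero positive definite trigonometric polynomial `f = ∑_{k∈H} c_k e_k`
(`c_k > 0`), whose frequencies are pairwise at distance at least `M`, with
`∫_{𝕋∖E} |f|^p ≤ ε ∫_𝕋 |f|^p`. -/
theorem posdef_concentration_with_gaps
    (p : ℝ) (hp : 0 < p) (hpe : ∀ m : ℕ, p ≠ 2 * m)
    (E : Set (AddCircle (1 : ℝ))) (hEm : MeasurableSet E) (hEs : (-E) = E)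
    (hE : 0 < volume E) (ε : ℝ) (hε : 0 < ε) (M : ℕ) :
    ∃ (H : Finset ℤ) (c : ℤ → ℝ), H.Nonempty ∧
      (∀ k ∈ H, 0 < c k) ∧
      (∀ k₁ ∈ H, ∀ k₂ ∈ H, k₁ ≠ k₂ → (M : ℤ) ≤ |k₁ - k₂|) ∧
      (∫ x in Eᶜ, ‖∑ k ∈ H, (c k : ℂ) * fourier k x‖ ^ p ∂volume) ≤
        ε * ∫ x : AddCircle (1 : ℝ), ‖∑ k ∈ H, (c k : ℂ) * fourier k x‖ ^ p := by
  classical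
  set w : AddCircle (1 : ℝ) → ℝ := fun x => Eᶜ.indicator (fun _ => 1) x - ε with hw
  have hwm : Measurable w := (measurable_const.indicator hEm.compl).sub_const ε
  have hwb (x : AddCircle (1 : ℝ)) : |w x| ≤ 1 + ε := by
    by_cases hx : x ∈ E <;> simp only [hw, Set.indicator, Set.mem_compl_iff, hx, not_true_eq_false,
      not_false_eq_true, if_true, if_false, abs_le] <;> constructor <;> linarith
  have hws (x : AddCircle (1 : ℝ)) : w (-x) = w x := by
    have : -x ∈ E ↔ x ∈ E := by rw [← Set.mem_neg, hEs]
    simp only [hw, Set.indicator, Set.mem_compl_iff, this]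
  have hneg : ∫ x in E, w x < 0 := by
    have : ∫ x in E, w x = ∫ x in E, -ε :=
      setIntegral_congr_fun hEm fun x hx => by simp [hw, hx]
    rw [this, setIntegral_const, smul_eq_mul]
    have : 0 < volume.real E := ENNReal.toReal_pos hE.ne' (measure_ne_top _ _)
    nlinarith
  obtain ⟨u, hu0, hus, hu⟩ := PosDefConcentration.exists_even_integral_neg hwm hwb hws hEm hneg
  obtain ⟨H, g, hg, hgneg⟩ := PosDefConcentration.isLimitDensity_of_even hp hpe M hu0 hus w _ _ _
    hwm hwb (PosDefConcentration.isPosDefGap_one M) (by simpa using hu)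
  have hgi := PosDefConcentration.integrable_of_continuous
    (PosDefConcentration.continuous_norm_rpow hp hg.continuous)
  obtain ⟨hH, hgap, c, hc, hgc⟩ := hg
  refine ⟨H, c, hH, hc, hgap, ?_⟩
  simp only [← hgc]
  have heq : ∫ x, w x * ‖g x‖ ^ p = (∫ x in Eᶜ, ‖g x‖ ^ p) - ε * ∫ x, ‖g x‖ ^ p := by
    rw [← integral_indicator hEm.compl, ← integral_const_mul,
      ← integral_sub (hgi.indicator hEm.compl) (hgi.const_mul ε)]
    refine integral_congr_ae (Filter.Eventually.of_forall fun x => ?_)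
    by_cases hx : x ∈ E <;> simp [hw, hx, sub_mul]
  linarith
end

section
/- Let 0 < q ≤ p < 2, let E ⊂ 𝕋 be a 0-symmetric open set with |E| > 0, and let ε > 0. Then there exists a positive definite trigonometric polynomial f such that ∫_{𝕋∖E} |f|^p ≤ ε · (∫_𝕋 |f|^q)^{p/q}. -/
open MeasureTheory Finset

open scoped NNReal ComplexConjugate

local notation "𝕋" => AddCircle (1 : ℝ)

instance isProbabilityMeasure_volume_unitAddCircle :
    IsProbabilityMeasure (volume : Measure 𝕋) :=
  ⟨by simp [AddCircle.measure_univ]⟩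

/-- The cone of positive definite trigonometric polynomials on the circle. -/
noncomputable def posDefPoly : Submodule ℝ≥0 C(𝕋, ℂ) :=
  Submodule.span ℝ≥0 (Set.range fourier)

lemma fourier_mem_posDefPoly (k : ℤ) : (fourier k : C(𝕋, ℂ)) ∈ posDefPoly :=
  Submodule.subset_span ⟨k, rfl⟩

lemma norm_fourier_apply (k : ℤ) (x : 𝕋) : ‖(fourier k x : ℂ)‖ = 1 := by
  rw [fourier_apply, Circle.norm_coe]

lemma fourier_mul_fourier (m n : ℤ) :
    (fourier m * fourier n : C(𝕋, ℂ)) = fourier (m + n) := by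
  ext x
  simp [-fourier_apply, fourier_add]

lemma mul_mem_posDefPoly {F G : C(𝕋, ℂ)} (hF : F ∈ posDefPoly) (hG : G ∈ posDefPoly) :
    F * G ∈ posDefPoly := by
  have h := Submodule.mul_mem_mul hF hG
  rw [posDefPoly, Submodule.span_mul_span] at h
  refine Submodule.span_mono ?_ h
  rintro _ ⟨_, ⟨m, rfl⟩, _, ⟨n, rfl⟩, rfl⟩
  exact ⟨m + n, (fourier_mul_fourier m n).symm⟩

lemma exists_coeff_of_mem_posDefPoly {F : C(𝕋, ℂ)} (hF : F ∈ posDefPoly) :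
    ∃ (H : Finset ℤ) (c : ℤ → ℝ), (∀ k ∈ H, 0 < c k) ∧
      ∀ x, F x = ∑ k ∈ H, (c k : ℂ) * fourier k x := by
  obtain ⟨c, rfl⟩ := (Finsupp.mem_span_range_iff_exists_finsupp).1 hF
  refine ⟨c.support, fun k => c k, fun k hk => ?_, fun x => ?_⟩
  · exact_mod_cast pos_iff_ne_zero.2 (Finsupp.mem_support_iff.1 hk)
  · simp [Finsupp.sum, -fourier_apply, ContinuousMap.sum_apply, NNReal.smul_def]

lemma exists_sub_of_mem_span_real {F : C(𝕋, ℂ)}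
    (hF : F ∈ Submodule.span ℝ (Set.range (fourier : ℤ → C(𝕋, ℂ)))) :
    ∃ G ∈ posDefPoly, ∃ H ∈ posDefPoly, F = G - H := by
  induction hF using Submodule.span_induction with
  | mem x hx =>
    exact ⟨x, Submodule.subset_span hx, 0, zero_mem _, by simp⟩
  | zero => exact ⟨0, zero_mem _, 0, zero_mem _, by simp⟩
  | add x y _ _ hx hy =>
    obtain ⟨G, hG, H, hH, rfl⟩ := hx
    obtain ⟨G', hG', H', hH', rfl⟩ := hy
    exact ⟨_, add_mem hG hG', _, add_mem hH hH', by abel⟩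
  | smul a x _ hx =>
    obtain ⟨G, hG, H, hH, rfl⟩ := hx
    rcases le_total 0 a with ha | ha
    · refine ⟨_, posDefPoly.smul_mem ⟨a, ha⟩ hG, _, posDefPoly.smul_mem ⟨a, ha⟩ hH, ?_⟩
      rw [smul_sub]; rfl
    · refine ⟨_, posDefPoly.smul_mem ⟨-a, neg_nonneg.2 ha⟩ hH, _,
        posDefPoly.smul_mem ⟨-a, neg_nonneg.2 ha⟩ hG, ?_⟩
      change _ = (-a) • H - (-a) • G
      ext x
      simp only [ContinuousMap.smul_apply, ContinuousMap.sub_apply, Complex.real_smul]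
      push_cast
      ring

lemma exists_mem_span_real_near {φ : C(𝕋, ℝ)} (hφ : ∀ x, φ (-x) = φ x) {η : ℝ} (hη : 0 < η) :
    ∃ F ∈ Submodule.span ℝ (Set.range (fourier : ℤ → C(𝕋, ℂ))), ∀ x, ‖F x - φ x‖ ≤ η := by
  let ψ : C(𝕋, ℂ) := ⟨fun x => (φ x : ℂ), by fun_prop⟩
  have hψ : ψ ∈ (Submodule.span ℂ (Set.range (@fourier 1))).topologicalClosure := by
    rw [span_fourier_closure_eq_top]; trivial
  obtain ⟨F, hF, hd⟩ := Metric.mem_closure_iff.1 hψ η hη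
  have hFη : ∀ y, ‖F y - φ y‖ ≤ η := fun y => by
    rw [norm_sub_rev, ← dist_eq_norm]
    exact (ContinuousMap.dist_apply_le_dist (f := ψ) (g := F) y).trans hd.le
  clear hd
  let R : C(𝕋, ℂ) → C(𝕋, ℂ) := fun G => ⟨fun x => conj (G (-x)), by fun_prop⟩
  have key : F + R F ∈ Submodule.span ℝ (Set.range (fourier : ℤ → C(𝕋, ℂ))) := by
    clear hFη
    induction hF using Submodule.closure_induction with
    | zero =>
      have : (0 : C(𝕋, ℂ)) + R 0 = 0 := by ext x; simp [R]
      rw [this]; exact zero_mem _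
    | add x y _ _ hx hy =>
      have : x + y + R (x + y) = (x + R x) + (y + R y) := by
        ext t; simp [R]; ring
      rw [this]; exact add_mem hx hy
    | smul_mem a x hx =>
      obtain ⟨k, rfl⟩ := hx
      have : a • fourier k + R (a • fourier k) = (2 * a.re) • (fourier k : C(𝕋, ℂ)) := by
        ext t
        have h : conj (fourier k (-t) : ℂ) = fourier k t := by
          rw [← fourier_neg]; simp [fourier_apply]
        simp only [ContinuousMap.add_apply, ContinuousMap.smul_apply, R, ContinuousMap.coe_mk,
          smul_eq_mul, map_mul, h, Complex.real_smul, ← add_mul, Complex.add_conj]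
      rw [this]
      exact Submodule.smul_mem _ _ (Submodule.subset_span ⟨k, rfl⟩)
  refine ⟨(1 / 2 : ℝ) • (F + R F), Submodule.smul_mem _ _ key, fun x => ?_⟩
  have h2 : ‖conj (F (-x)) - φ x‖ ≤ η := by
    rw [← hφ x, ← Complex.conj_ofReal, ← map_sub, RCLike.norm_conj]
    exact hFη _
  have : ((1 / 2 : ℝ) • (F + R F)) x - φ x
      = (1 / 2 : ℂ) * ((F x - φ x) + (conj (F (-x)) - φ x)) := by
    simp [R]; ring
  rw [this, norm_mul]
  have := norm_add_le (F x - φ x) (conj (F (-x)) - φ x)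
  have := hFη x
  norm_num
  linarith

/-- The one-sided Dirichlet kernel with `n` terms. -/
noncomputable def dirichlet (n : ℕ) : C(𝕋, ℂ) := ∑ k ∈ range n, fourier (k : ℤ)

lemma dirichlet_add (m n : ℕ) : dirichlet (m + n) = dirichlet m + fourier m * dirichlet n := by
  simp [dirichlet, sum_range_add, mul_sum, fourier_mul_fourier]

lemma integral_fourier_eq_zero {k : ℤ} (hk : k ≠ 0) : ∫ x : 𝕋, (fourier k x : ℂ) = 0 :=
  integral_eq_zero_of_add_right_eq_neg (μ := volume) (fourier_add_half_inv_index hk one_pos)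

lemma integral_norm_dirichlet_sq (n : ℕ) : ∫ x, ‖dirichlet n x‖ ^ 2 = n := by
  have h : ∀ x, ((‖dirichlet n x‖ ^ 2 : ℝ) : ℂ)
      = ∑ j ∈ range n, ∑ k ∈ range n, fourier ((j : ℤ) - k) x := fun x => by
    push_cast
    rw [← Complex.mul_conj']
    simp only [dirichlet, ContinuousMap.sum_apply, map_sum, sum_mul_sum, sub_eq_add_neg,
      fourier_add, fourier_neg]
  have hi : ∀ k : ℤ, Integrable (fun x : 𝕋 => (fourier k x : ℂ)) := fun k =>
    (fourier k : C(𝕋, ℂ)).continuous.integrable_of_hasCompactSupport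
      (HasCompactSupport.of_compactSpace _)
  rw [← Complex.ofReal_inj, ← integral_complex_ofReal, integral_congr_ae (.of_forall h),
    integral_finsetSum _ fun j _ => integrable_finsetSum _ fun k _ => hi _]
  have : ∀ j ∈ range n, ∫ x, ∑ k ∈ range n, (fourier ((j : ℤ) - k) x : ℂ) = 1 := fun j hj => by
    rw [integral_finsetSum _ fun k _ => hi _, sum_eq_single_of_mem j hj]
    · simp
    · intro k _ hk
      exact integral_fourier_eq_zero (by omega)
  rw [sum_congr rfl this]
  simp

lemma norm_dirichlet_le (n : ℕ) (x : 𝕋) : ‖dirichlet n x‖ ≤ n := by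
  rw [dirichlet, ContinuousMap.sum_apply]
  refine (norm_sum_le _ _).trans ?_
  simp [-fourier_apply, norm_fourier_apply]

/-- A trapezoidal kernel of Fejér type: its coefficients are nonnegative and equal to one on
`[0, n)`. -/
noncomputable def trapezoid (n : ℕ) : C(𝕋, ℂ) :=
  (n : ℝ≥0)⁻¹ • ∑ l ∈ range n, fourier (-(l : ℤ)) * dirichlet (2 * n)

lemma trapezoid_sub_dirichlet_mem {n : ℕ} (hn : n ≠ 0) :
    trapezoid n - dirichlet n ∈ posDefPoly := by
  have h : trapezoid n - dirichlet n
      = (n : ℝ≥0)⁻¹ • ∑ l ∈ range n, (fourier (-(l : ℤ)) * dirichlet (2 * n) - dirichlet n) := by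
    rw [sum_sub_distrib, smul_sub, trapezoid]
    congr 1
    rw [sum_const, card_range, ← Nat.cast_smul_eq_nsmul ℝ≥0, smul_smul,
      inv_mul_cancel₀ (by exact_mod_cast hn), one_smul]
  rw [h]
  refine Submodule.smul_mem _ _ (sum_mem fun l hl => ?_)
  rw [mem_range] at hl
  have h1 : 2 * n = l + (n + (n - l)) := by omega
  have h2 : fourier (-(l : ℤ)) * dirichlet (2 * n) - dirichlet n
      = fourier (-(l : ℤ)) * dirichlet l + fourier n * dirichlet (n - l) := by
    have h3 : (fourier (-(l : ℤ)) * fourier l : C(𝕋, ℂ)) = 1 := by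
      rw [fourier_mul_fourier]; ext; simp
    rw [h1, dirichlet_add, dirichlet_add]
    linear_combination (dirichlet n + fourier n * dirichlet (n - l)) * h3
  have h4 : ∀ m, dirichlet m ∈ posDefPoly := fun m =>
    sum_mem fun k _ => fourier_mem_posDefPoly k
  rw [h2]
  exact add_mem (mul_mem_posDefPoly (fourier_mem_posDefPoly _) (h4 _))
    (mul_mem_posDefPoly (fourier_mem_posDefPoly _) (h4 _))

lemma norm_trapezoid_le (n : ℕ) (x : 𝕋) :
    ‖trapezoid n x‖ ≤ 2 * (n : ℝ)⁻¹ * ‖dirichlet n x‖ ^ 2 := by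
  have h1 : ∑ l ∈ range n, (fourier (-(l : ℤ)) x : ℂ) = conj (dirichlet n x) := by
    simp only [dirichlet, ContinuousMap.sum_apply, map_sum, fourier_neg]
  have h2 : trapezoid n x = (n : ℂ)⁻¹ * (conj (dirichlet n x) * dirichlet (2 * n) x) := by
    rw [trapezoid, ← h1, ← sum_mul]
    simp [-fourier_apply, NNReal.smul_def]
  have h3 : ‖dirichlet (2 * n) x‖ ≤ 2 * ‖dirichlet n x‖ := by
    rw [two_mul, dirichlet_add, ContinuousMap.add_apply, ContinuousMap.mul_apply]
    refine (norm_add_le _ _).trans ?_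
    rw [norm_mul, norm_fourier_apply, one_mul, two_mul]
  rw [h2, norm_mul, norm_mul, norm_inv, RCLike.norm_conj, Complex.norm_natCast]
  calc _ ≤ (n : ℝ)⁻¹ * (‖dirichlet n x‖ * (2 * ‖dirichlet n x‖)) := by gcongr
    _ = _ := by ring

/-- The pair of Rudin–Shapiro polynomials with `2 ^ n` terms. -/
noncomputable def rudinShapiro : ℕ → C(𝕋, ℂ) × C(𝕋, ℂ)
  | 0 => (1, 1)
  | n + 1 => ((rudinShapiro n).1 + fourier (2 ^ n : ℕ) * (rudinShapiro n).2,
      (rudinShapiro n).1 - fourier (2 ^ n : ℕ) * (rudinShapiro n).2)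

lemma norm_sq_rudinShapiro (n : ℕ) (x : 𝕋) :
    ‖(rudinShapiro n).1 x‖ ^ 2 + ‖(rudinShapiro n).2 x‖ ^ 2 = 2 * 2 ^ n := by
  induction n with
  | zero => norm_num [rudinShapiro]
  | succ n ih =>
    have h := parallelogram_law_with_norm ℝ ((rudinShapiro n).1 x)
      (fourier (2 ^ n : ℕ) x * (rudinShapiro n).2 x)
    have h1 : ‖(fourier ((2 ^ n : ℕ) : ℤ) x : ℂ) * (rudinShapiro n).2 x‖
        = ‖(rudinShapiro n).2 x‖ := by
      rw [norm_mul, norm_fourier_apply, one_mul]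
    rw [h1] at h
    simp only [rudinShapiro, ContinuousMap.add_apply, ContinuousMap.sub_apply,
      ContinuousMap.mul_apply]
    rw [pow_succ 2 n]
    linarith

lemma dirichlet_add_sub_rudinShapiro_mem (n : ℕ) :
    dirichlet (2 ^ n) + (rudinShapiro n).1 ∈ posDefPoly ∧
    dirichlet (2 ^ n) - (rudinShapiro n).1 ∈ posDefPoly ∧
    dirichlet (2 ^ n) + (rudinShapiro n).2 ∈ posDefPoly ∧
    dirichlet (2 ^ n) - (rudinShapiro n).2 ∈ posDefPoly := by
  induction n with
  | zero =>
    have h : dirichlet 1 = 1 := by ext; simp [dirichlet]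
    have h1 : (1 : C(𝕋, ℂ)) ∈ posDefPoly := by
      simpa [← h, dirichlet] using fourier_mem_posDefPoly 0
    simpa [rudinShapiro, h] using add_mem h1 h1
  | succ n ih =>
    obtain ⟨h1, h2, h3, h4⟩ := ih
    have hf := fun {G} => mul_mem_posDefPoly (G := G) (fourier_mem_posDefPoly ((2 ^ n : ℕ) : ℤ))
    rw [pow_succ, mul_two, dirichlet_add]
    simp only [rudinShapiro]
    refine ⟨?_, ?_, ?_, ?_⟩
    · convert add_mem h1 (hf h3) using 1; ring
    · convert add_mem h2 (hf h4) using 1; ring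
    · convert add_mem h1 (hf h4) using 1; ring
    · convert add_mem h2 (hf h3) using 1; ring

lemma integrable_of_continuous_unitAddCircle {F : Type*} [NormedAddCommGroup F] {f : 𝕋 → F}
    (hf : Continuous f) : Integrable f :=
  hf.integrable_of_hasCompactSupport (HasCompactSupport.of_compactSpace _)

lemma add_rpow_le_two_rpow_mul {a b p : ℝ} (ha : 0 ≤ a) (hb : 0 ≤ b) (hp : 0 ≤ p) :
    (a + b) ^ p ≤ 2 ^ p * (a ^ p + b ^ p) := by
  have h1 : a + b ≤ 2 * max a b := by
    linarith [le_max_left a b, le_max_right a b]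
  have h2 : (max a b) ^ p ≤ a ^ p + b ^ p := by
    rcases max_choice a b with h | h <;> rw [h] <;>
      linarith [Real.rpow_nonneg ha p, Real.rpow_nonneg hb p]
  calc (a + b) ^ p ≤ (2 * max a b) ^ p := by gcongr
    _ = 2 ^ p * (max a b) ^ p := Real.mul_rpow zero_le_two (ha.trans (le_max_left a b))
    _ ≤ _ := by gcongr

lemma integral_norm_trapezoid_rpow_le {n : ℕ} (hn : n ≠ 0) {p : ℝ} (hp : 0 < p) :
    ∫ x, ‖trapezoid n x‖ ^ p ≤ 3 * (2 * (n : ℝ)) ^ (max p 1 - 1) := by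
  have hn1 : (1 : ℝ) ≤ n := by exact_mod_cast Nat.one_le_iff_ne_zero.2 hn
  have hr : 0 ≤ max p 1 - 1 := sub_nonneg.2 (le_max_right _ _)
  have hsup : ∀ x, ‖trapezoid n x‖ ≤ 2 * (n : ℝ) := fun x => by
    refine (norm_trapezoid_le n x).trans ?_
    calc 2 * (n : ℝ)⁻¹ * ‖dirichlet n x‖ ^ 2 ≤ 2 * (n : ℝ)⁻¹ * (n : ℝ) ^ 2 := by
          gcongr; exact norm_dirichlet_le n x
      _ = 2 * (n : ℝ) := by field_simp
  have hint : ∫ x, ‖trapezoid n x‖ ≤ 2 := by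
    calc ∫ x, ‖trapezoid n x‖ ≤ ∫ x, 2 * (n : ℝ)⁻¹ * ‖dirichlet n x‖ ^ 2 :=
          integral_mono (integrable_of_continuous_unitAddCircle (by fun_prop))
            (integrable_of_continuous_unitAddCircle (by fun_prop)) (norm_trapezoid_le n)
      _ = 2 := by
          rw [integral_const_mul, integral_norm_dirichlet_sq]; field_simp
  have hpt : ∀ x, ‖trapezoid n x‖ ^ p
      ≤ 1 + (2 * (n : ℝ)) ^ (max p 1 - 1) * ‖trapezoid n x‖ := fun x => by
    have h0 := norm_nonneg (trapezoid n x)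
    rcases le_total ‖trapezoid n x‖ 1 with h | h
    · have := Real.rpow_le_one h0 h hp.le
      have : 0 ≤ (2 * (n : ℝ)) ^ (max p 1 - 1) * ‖trapezoid n x‖ := by positivity
      linarith
    · calc ‖trapezoid n x‖ ^ p ≤ ‖trapezoid n x‖ ^ ((max p 1 - 1) + 1) :=
            Real.rpow_le_rpow_of_exponent_le h (by simp)
        _ = ‖trapezoid n x‖ ^ (max p 1 - 1) * ‖trapezoid n x‖ := by
            rw [Real.rpow_add (by linarith), Real.rpow_one]
        _ ≤ (2 * (n : ℝ)) ^ (max p 1 - 1) * ‖trapezoid n x‖ := by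
            gcongr; exact hsup x
        _ ≤ _ := by linarith
  have hone : 1 ≤ (2 * (n : ℝ)) ^ (max p 1 - 1) := Real.one_le_rpow (by linarith) hr
  calc ∫ x, ‖trapezoid n x‖ ^ p
      ≤ ∫ x, (1 + (2 * (n : ℝ)) ^ (max p 1 - 1) * ‖trapezoid n x‖) :=
        integral_mono
          (integrable_of_continuous_unitAddCircle
            ((trapezoid n).continuous.norm.rpow_const fun _ => Or.inr hp.le))
          (integrable_of_continuous_unitAddCircle (by fun_prop)) hpt
    _ = 1 + (2 * (n : ℝ)) ^ (max p 1 - 1) * ∫ x, ‖trapezoid n x‖ := by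
        rw [integral_add (integrable_const _)
          (integrable_of_continuous_unitAddCircle (by fun_prop)), integral_const_mul]
        simp
    _ ≤ (2 * (n : ℝ)) ^ (max p 1 - 1) + (2 * (n : ℝ)) ^ (max p 1 - 1) * 2 := by gcongr
    _ = _ := by ring

lemma tendsto_integral_norm_trapezoid_rpow {p : ℝ} (hp : 0 < p) (hp2 : p < 2) :
    Filter.Tendsto (fun n : ℕ => ∫ x, ((√(2 ^ n))⁻¹ * ‖trapezoid (2 ^ n) x‖) ^ p)
      Filter.atTop (nhds 0) := by
  set r := max p 1 - 1 with hr
  have hrp : 0 < p / 2 - r := by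
    rcases max_choice p 1 with h | h <;> rw [hr, h] <;> linarith
  have hlim : Filter.Tendsto (fun n : ℕ => 3 * 2 ^ r * ((2 : ℝ) ^ n) ^ (-(p / 2 - r)))
      Filter.atTop (nhds 0) := by
    rw [← mul_zero (3 * 2 ^ r : ℝ)]
    exact ((tendsto_rpow_neg_atTop hrp).comp
      (tendsto_pow_atTop_atTop_of_one_lt one_lt_two)).const_mul _
  refine squeeze_zero (fun n => integral_nonneg fun x => by positivity) (fun n => ?_) hlim
  have hN : (0 : ℝ) < 2 ^ n := by positivity
  have h1 := integral_norm_trapezoid_rpow_le (n := 2 ^ n) (by positivity) hp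
  push_cast at h1
  have h2 : ((√(2 ^ n))⁻¹ : ℝ) ^ p = ((2 : ℝ) ^ n) ^ (-(p / 2)) := by
    rw [Real.sqrt_eq_rpow, ← Real.rpow_neg hN.le, ← Real.rpow_mul hN.le]
    congr 1; ring
  calc ∫ x, ((√(2 ^ n))⁻¹ * ‖trapezoid (2 ^ n) x‖) ^ p
      = ((2 : ℝ) ^ n) ^ (-(p / 2)) * ∫ x, ‖trapezoid (2 ^ n) x‖ ^ p := by
        rw [← integral_const_mul]
        refine integral_congr_ae (.of_forall fun x => ?_)
        simp only
        rw [Real.mul_rpow (by positivity) (norm_nonneg _), h2]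
    _ ≤ ((2 : ℝ) ^ n) ^ (-(p / 2)) * (3 * (2 * 2 ^ n) ^ r) := by gcongr
    _ = _ := by
        rw [Real.mul_rpow zero_le_two hN.le, neg_sub, sub_eq_neg_add, Real.rpow_add hN]
        ring

lemma exists_flat_multiplier (Φ : C(𝕋, ℂ)) (n : ℕ) :
    ∃ R : C(𝕋, ℂ), dirichlet (2 ^ n) + R ∈ posDefPoly ∧ dirichlet (2 ^ n) - R ∈ posDefPoly ∧
      (∀ x, ‖R x‖ ≤ √2 * √(2 ^ n)) ∧
      2 ^ n * ∫ x, ‖Φ x‖ ^ 2 ≤ ∫ x, ‖Φ x * R x‖ ^ 2 := by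
  obtain ⟨h1, h2, h3, h4⟩ := dirichlet_add_sub_rudinShapiro_mem n
  have hsum : (∫ x, ‖Φ x * (rudinShapiro n).1 x‖ ^ 2) + ∫ x, ‖Φ x * (rudinShapiro n).2 x‖ ^ 2
      = 2 * (2 ^ n * ∫ x, ‖Φ x‖ ^ 2) := by
    rw [← integral_add (integrable_of_continuous_unitAddCircle (by fun_prop))
      (integrable_of_continuous_unitAddCircle (by fun_prop)), ← mul_assoc, ← integral_const_mul]
    refine integral_congr_ae (.of_forall fun x => ?_)
    simp only [norm_mul, mul_pow]
    rw [← mul_add, norm_sq_rudinShapiro]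
    ring
  have hle : ∀ {a b : ℝ}, a ^ 2 + b ^ 2 = 2 * 2 ^ n → a ≤ √2 * √(2 ^ n) := fun {a b} h => by
    rw [← Real.sqrt_mul zero_le_two]
    exact Real.le_sqrt_of_sq_le (by linarith [sq_nonneg b])
  rcases le_total (∫ x, ‖Φ x * (rudinShapiro n).1 x‖ ^ 2)
    (∫ x, ‖Φ x * (rudinShapiro n).2 x‖ ^ 2) with h | h
  · exact ⟨_, h3, h4, fun x => hle ((add_comm _ _).trans (norm_sq_rudinShapiro n x)), by linarith⟩
  · exact ⟨_, h1, h2, fun x => hle (norm_sq_rudinShapiro n x), by linarith⟩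

lemma rpow_mul_integral_sq_le {g : 𝕋 → ℂ} (hg : Continuous g) {t q : ℝ} (ht : ∀ x, ‖g x‖ ≤ t)
    (hq : 0 < q) (hq2 : q < 2) :
    t ^ (q - 2) * ∫ x, ‖g x‖ ^ 2 ≤ ∫ x, ‖g x‖ ^ q := by
  rw [← integral_const_mul]
  refine integral_mono (integrable_of_continuous_unitAddCircle (by fun_prop))
    (integrable_of_continuous_unitAddCircle (hg.norm.rpow_const fun _ => Or.inr hq.le))
    fun x => ?_
  simp only
  rcases (norm_nonneg (g x)).eq_or_lt with h | h
  · simp [← h, Real.zero_rpow hq.ne']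
  · calc t ^ (q - 2) * ‖g x‖ ^ 2 ≤ ‖g x‖ ^ (q - 2) * ‖g x‖ ^ (2 : ℝ) := by
          rw [Real.rpow_two]
          exact mul_le_mul_of_nonneg_right
            (Real.rpow_le_rpow_of_nonpos h (ht x) (sub_nonpos.2 hq2.le)) (sq_nonneg _)
      _ = ‖g x‖ ^ q := by rw [← Real.rpow_add h]; congr 1; ring

lemma exists_even_bump {E : Set 𝕋} (hEo : IsOpen E) (hEs : -E = E) (hE : E.Nonempty) :
    ∃ φ : C(𝕋, ℝ), (∀ x, φ (-x) = φ x) ∧ (∀ x ∈ Eᶜ, φ x = 0) ∧ (∀ x, |φ x| ≤ 1) ∧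
      0 < ∫ x, φ x ^ 2 := by
  obtain ⟨a, ha⟩ := hE
  have ha' : -a ∈ E := by rw [← hEs]; simpa
  obtain ⟨f, hf0, hf1, hf⟩ := exists_continuous_zero_one_of_isClosed hEo.isClosed_compl
    (Set.toFinite {a, -a}).isClosed (by
      rw [Set.disjoint_compl_left_iff_subset]
      rintro x (rfl | rfl) <;> assumption)
  refine ⟨⟨fun x => f x * f (-x), by fun_prop⟩, fun x => by simp [mul_comm], fun x hx => ?_,
    fun x => ?_, ?_⟩
  · simp [hf0 hx]
  · have h1 := hf x
    have h2 := hf (-x)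
    simp only [ContinuousMap.coe_mk]
    rw [abs_of_nonneg (mul_nonneg h1.1 h2.1)]
    exact mul_le_one₀ h1.2 h2.1 h2.2
  · refine Continuous.integral_pos_of_hasCompactSupport_nonneg_nonzero (x := a)
      (by fun_prop) (HasCompactSupport.of_compactSpace _) (fun x => sq_nonneg _) ?_
    have h1 : f a = 1 := hf1 (by simp)
    have h2 : f (-a) = 1 := hf1 (by simp)
    simp [h1, h2]

lemma exists_mem_posDefPoly_split {G H : C(𝕋, ℂ)} (hG : G ∈ posDefPoly) (hH : H ∈ posDefPoly)
    (n : ℕ) :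
    ∃ F ∈ posDefPoly, ∃ g : C(𝕋, ℂ),
      (∀ x, ‖g x‖ ≤ √2 * ‖(G - H) x‖) ∧
      (∀ x, ‖F x - g x‖ ≤ ‖G + H‖ * ((√(2 ^ n))⁻¹ * ‖trapezoid (2 ^ n) x‖)) ∧
      ∫ x, ‖(G - H) x‖ ^ 2 ≤ ∫ x, ‖g x‖ ^ 2 := by
  obtain ⟨R, hR1, hR2, hR3, hR4⟩ := exists_flat_multiplier (G - H) n
  have hs : (0 : ℝ) < √(2 ^ n) := by positivity
  have hB := trapezoid_sub_dirichlet_mem (n := 2 ^ n) (by positivity)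
  set B := trapezoid (2 ^ n)
  set s : ℝ := (√(2 ^ n))⁻¹ with hsdef
  have hs0 : 0 ≤ s := by positivity
  have hp : B + R ∈ posDefPoly := by
    convert add_mem hB hR1 using 1; ring
  have hm : B - R ∈ posDefPoly := by
    convert add_mem hB hR2 using 1; ring
  refine ⟨(⟨s, hs0⟩ : ℝ≥0) • (G * (B + R) + H * (B - R)),
    posDefPoly.smul_mem _ (add_mem (mul_mem_posDefPoly hG hp) (mul_mem_posDefPoly hH hm)),
    s • ((G - H) * R), fun x => ?_, fun x => ?_, ?_⟩
  · rw [ContinuousMap.smul_apply, ContinuousMap.mul_apply, norm_smul, norm_mul,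
      Real.norm_of_nonneg hs0]
    calc s * (‖(G - H) x‖ * ‖R x‖) ≤ s * (‖(G - H) x‖ * (√2 * √(2 ^ n))) := by
          gcongr; exact hR3 x
      _ = √2 * ‖(G - H) x‖ := by rw [hsdef]; field_simp
  · have h : ((⟨s, hs0⟩ : ℝ≥0) • (G * (B + R) + H * (B - R))) x - (s • ((G - H) * R)) x
        = (G + H) x * ((s : ℂ) * B x) := by
      have hsz : ∀ z : ℂ, (⟨s, hs0⟩ : ℝ≥0) • z = s * z := fun z => Complex.real_smul
      simp only [ContinuousMap.smul_apply, hsz, ContinuousMap.add_apply,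
        ContinuousMap.mul_apply, ContinuousMap.sub_apply, Complex.real_smul]
      ring
    rw [h, norm_mul, norm_mul, Complex.norm_real, Real.norm_of_nonneg hs0]
    gcongr
    exact ContinuousMap.norm_coe_le_norm _ x
  · have h : ∫ x, ‖(s • ((G - H) * R)) x‖ ^ 2 = (2 ^ n)⁻¹ * ∫ x, ‖(G - H) x * R x‖ ^ 2 := by
      rw [← integral_const_mul]
      refine integral_congr_ae (.of_forall fun x => ?_)
      simp only [ContinuousMap.smul_apply, norm_smul, mul_pow, ContinuousMap.mul_apply]
      rw [Real.norm_of_nonneg hs0, hsdef, inv_pow, Real.sq_sqrt (by positivity)]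
    rw [h, le_inv_mul_iff₀ (by positivity)]
    exact hR4

lemma quarter_le_integral_sq {φ : C(𝕋, ℝ)} {Φ : C(𝕋, ℂ)} {η : ℝ}
    (h : ∀ x, ‖Φ x - φ x‖ ≤ η) (hηφ : η ^ 2 ≤ (∫ x, φ x ^ 2) / 4) :
    (∫ x, φ x ^ 2) / 4 ≤ ∫ x, ‖Φ x‖ ^ 2 := by
  have hpt : ∀ x, φ x ^ 2 ≤ 2 * ‖Φ x‖ ^ 2 + 2 * η ^ 2 := fun x => by
    have h1 : |φ x| ≤ ‖Φ x‖ + η := by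
      have := norm_sub_norm_le (φ x : ℂ) (Φ x)
      rw [norm_sub_rev, Complex.norm_real, Real.norm_eq_abs] at this
      linarith [h x]
    calc φ x ^ 2 = |φ x| ^ 2 := (sq_abs _).symm
      _ ≤ (‖Φ x‖ + η) ^ 2 := by gcongr
      _ ≤ _ := by linarith [sq_nonneg (‖Φ x‖ - η), add_sq ‖Φ x‖ η, sub_sq ‖Φ x‖ η]
  have hi : Integrable (fun x => 2 * ‖Φ x‖ ^ 2) :=
    integrable_of_continuous_unitAddCircle (by fun_prop)
  have := integral_mono (integrable_of_continuous_unitAddCircle (by fun_prop))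
    (hi.add (integrable_const (2 * η ^ 2))) hpt
  rw [integral_add' hi (integrable_const _), integral_const_mul] at this
  simp only [integral_const, probReal_univ, one_smul] at this
  linarith

/-- **Strong concentration (Theorem 4(i) for `p < 2`).** For `0 < q ≤ p < 2`, any
`0`-symmetric open set `E ⊆ 𝕋` of positive measure and any `ε > 0`, there is a
nonzero positive definite trigonometric polynomial `f` such that
`∫_{𝕋∖E} |f|^p ≤ ε (∫_𝕋 |f|^q)^{p/q}`. -/
theorem strong_concentration_lt_two
    (p q : ℝ) (hq0 : 0 < q) (hqp : q ≤ p) (hp2 : p < 2)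
    (E : Set (AddCircle (1 : ℝ))) (hEo : IsOpen E) (hEs : (-E) = E)
    (hE : 0 < volume E) (ε : ℝ) (hε : 0 < ε) :
    ∃ (H : Finset ℤ) (c : ℤ → ℝ), H.Nonempty ∧ (∀ k ∈ H, 0 < c k) ∧
      (∫ x in Eᶜ, ‖∑ k ∈ H, (c k : ℂ) * fourier k x‖ ^ p ∂volume) ≤
        ε * (∫ x : AddCircle (1 : ℝ), ‖∑ k ∈ H, (c k : ℂ) * fourier k x‖ ^ q) ^ (p / q) := by
  have hp0 : 0 < p := hq0.trans_le hqp
  obtain ⟨φ, hφs, hφE, hφ1, hc0⟩ := exists_even_bump hEo hEs (nonempty_of_measure_ne_zero hE.ne')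
  set c₀ := ∫ x, φ x ^ 2
  set L : ℝ := (√2 * 2) ^ (q - 2) * (c₀ / 4) with hL
  set m : ℝ := L / 2 ^ q / 2 with hm
  have hL0 : 0 < L := by positivity
  have hm0 : 0 < m := by positivity
  set δ : ℝ := ε * m ^ (p / q) with hδ
  have hδ0 : 0 < δ := by positivity
  obtain ⟨η, hη0, hη1, hηc, hηδ⟩ : ∃ η : ℝ, 0 < η ∧ η ≤ 1 ∧ η ^ 2 ≤ c₀ / 4 ∧
      2 ^ p * (√2 * η) ^ p ≤ δ / 2 := by
    have h1 : Filter.Tendsto (fun η : ℝ => η ^ 2) (nhdsWithin 0 (Set.Ioi 0)) (nhds 0) := by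
      have : Continuous fun η : ℝ => η ^ 2 := by fun_prop
      simpa using (this.tendsto 0).mono_left nhdsWithin_le_nhds
    have h2 : Filter.Tendsto (fun η : ℝ => 2 ^ p * (√2 * η) ^ p)
        (nhdsWithin 0 (Set.Ioi 0)) (nhds 0) := by
      have : Continuous fun η : ℝ => 2 ^ p * (√2 * η) ^ p :=
        continuous_const.mul ((continuous_const.mul continuous_id).rpow_const
          fun _ => Or.inr hp0.le)
      simpa [Real.zero_rpow hp0.ne'] using (this.tendsto 0).mono_left nhdsWithin_le_nhds
    have h3 : ∀ᶠ η : ℝ in nhdsWithin 0 (Set.Ioi 0), η ≤ 1 :=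
      nhdsWithin_le_nhds (Iic_mem_nhds one_pos)
    have h4 : ∀ᶠ η : ℝ in nhdsWithin 0 (Set.Ioi 0), 0 < η := self_mem_nhdsWithin
    exact (h4.and (h3.and ((h1.eventually_le_const (by positivity : 0 < c₀ / 4)).and
        (h2.eventually_le_const (by positivity : 0 < δ / 2))))).exists
  obtain ⟨Φ, hΦ, hΦφ⟩ := exists_mem_span_real_near hφs hη0
  obtain ⟨G, hG, K, hK, rfl⟩ := exists_sub_of_mem_span_real hΦ
  have hΦ2 := quarter_le_integral_sq hΦφ hηc
  have hΦle : ∀ x, ‖(G - K) x‖ ≤ 2 := fun x => by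
    have h1 := norm_sub_norm_le ((G - K) x) (φ x)
    rw [Complex.norm_real, Real.norm_eq_abs] at h1
    linarith [hΦφ x, hφ1 x]
  have hΦE : ∀ x ∈ Eᶜ, ‖(G - K) x‖ ≤ η := fun x hx => by simpa [hφE x hx] using hΦφ x
  set A := ‖G + K‖
  obtain ⟨n, hnq, hnp⟩ : ∃ n : ℕ,
      A ^ q * ∫ x, ((√(2 ^ n))⁻¹ * ‖trapezoid (2 ^ n) x‖) ^ q ≤ m ∧
      2 ^ p * (A ^ p * ∫ x, ((√(2 ^ n))⁻¹ * ‖trapezoid (2 ^ n) x‖) ^ p) ≤ δ / 2 := by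
    have h1 := (tendsto_integral_norm_trapezoid_rpow hq0 (hqp.trans_lt hp2)).const_mul (A ^ q)
    have h2 := ((tendsto_integral_norm_trapezoid_rpow hp0 hp2).const_mul (A ^ p)).const_mul (2 ^ p)
    simp only [mul_zero] at h1 h2
    exact ((h1.eventually_le_const hm0).and (h2.eventually_le_const (half_pos hδ0))).exists
  obtain ⟨F, hF, g, hg, hFg, hg2⟩ := exists_mem_posDefPoly_split hG hK n
  set b : 𝕋 → ℝ := fun x => (√(2 ^ n))⁻¹ * ‖trapezoid (2 ^ n) x‖ with hb
  have hb0 : ∀ x, 0 ≤ b x := fun x => by positivity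
  have hbc : Continuous b := by fun_prop
  have hbi : ∀ {r : ℝ}, 0 < r → Integrable fun x => (A * b x) ^ r := fun {r} hr =>
    integrable_of_continuous_unitAddCircle
      ((continuous_const.mul hbc).rpow_const fun _ => Or.inr hr.le)
  have hbA : ∀ {r : ℝ}, ∫ x, (A * b x) ^ r = A ^ r * ∫ x, b x ^ r := fun {r} => by
    rw [← integral_const_mul]
    exact integral_congr_ae (.of_forall fun x => Real.mul_rpow (norm_nonneg _) (hb0 x))
  have hci : ∀ (f : C(𝕋, ℂ)) {r : ℝ}, 0 < r → Integrable fun x => ‖f x‖ ^ r := fun f r hr =>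
    integrable_of_continuous_unitAddCircle (f.continuous.norm.rpow_const fun _ => Or.inr hr.le)
  have hlow : m ≤ ∫ x, ‖F x‖ ^ q := by
    have h1 : L ≤ ∫ x, ‖g x‖ ^ q := by
      refine le_trans ?_ (rpow_mul_integral_sq_le g.continuous (t := √2 * 2)
        (fun x => (hg x).trans (by gcongr; exact hΦle x)) hq0 (hqp.trans_lt hp2))
      rw [hL]
      gcongr
      exact hΦ2.trans hg2
    have h2 : ∫ x, ‖g x‖ ^ q ≤ 2 ^ q * ((∫ x, ‖F x‖ ^ q) + A ^ q * ∫ x, b x ^ q) := by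
      rw [← hbA, ← integral_add (hci F hq0) (hbi hq0), ← integral_const_mul]
      refine integral_mono (hci g hq0) (((hci F hq0).add (hbi hq0)).const_mul _) fun x => ?_
      refine le_trans ?_ (add_rpow_le_two_rpow_mul (norm_nonneg _)
        (mul_nonneg (norm_nonneg _) (hb0 x)) hq0.le)
      refine Real.rpow_le_rpow (norm_nonneg _) ?_ hq0.le
      have := norm_sub_norm_le (g x) (F x)
      rw [norm_sub_rev] at this
      linarith [hFg x]
    have h3 : L / 2 ^ q ≤ (∫ x, ‖F x‖ ^ q) + A ^ q * ∫ x, b x ^ q := by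
      rw [div_le_iff₀' (by positivity)]
      exact h1.trans h2
    linarith
  have hup : ∫ x in Eᶜ, ‖F x‖ ^ p ≤ δ := by
    calc ∫ x in Eᶜ, ‖F x‖ ^ p ≤ ∫ x in Eᶜ, 2 ^ p * ((√2 * η) ^ p + (A * b x) ^ p) := by
          refine setIntegral_mono_on (hci F hp0).integrableOn
            (((integrable_const _).add (hbi hp0)).const_mul _).integrableOn
            hEo.measurableSet.compl fun x hx => ?_
          refine le_trans ?_ (add_rpow_le_two_rpow_mul (by positivity)
            (mul_nonneg (norm_nonneg _) (hb0 x)) hp0.le)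
          refine Real.rpow_le_rpow (norm_nonneg _) ?_ hp0.le
          have h1 : √2 * ‖(G - K) x‖ ≤ √2 * η := by gcongr; exact hΦE x hx
          linarith [norm_sub_norm_le (F x) (g x), hFg x, hg x]
      _ ≤ ∫ x, 2 ^ p * ((√2 * η) ^ p + (A * b x) ^ p) :=
          setIntegral_le_integral (((integrable_const _).add (hbi hp0)).const_mul _)
            (.of_forall fun x => by
              have := mul_nonneg (norm_nonneg (G + K)) (hb0 x)
              simp only [Pi.zero_apply]
              positivity)
      _ = 2 ^ p * (√2 * η) ^ p + 2 ^ p * (A ^ p * ∫ x, b x ^ p) := by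
          rw [integral_const_mul, integral_add (integrable_const _) (hbi hp0), hbA]
          simp [mul_add]
      _ ≤ δ := by linarith
  obtain ⟨H, c, hc, hFc⟩ := exists_coeff_of_mem_posDefPoly hF
  refine ⟨H, c, ?_, hc, ?_⟩
  · rw [nonempty_iff_ne_empty]
    rintro rfl
    simp only [hFc, sum_empty, norm_zero, Real.zero_rpow hq0.ne', integral_zero] at hlow
    exact hm0.not_ge hlow
  · simp only [← hFc]
    refine hup.trans ?_
    rw [hδ]
    have hpq : 0 ≤ p / q := by positivity
    gcongr
end

section
/- Let p > 2 with p not an even integer, and let j be an odd integer with j > p/2. Set G_0 = (1 + e_j)(1 + e_{j+1}) and g_0 = (1 + e_j)(1 − e_{j+1}). Then there exists q(p) < p such that for all q with q(p) < q ≤ p one has ‖G_0‖_{L^p(𝕋)} < ‖g_0‖_{L^q(𝕋)}. -/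
open MeasureTheory Finset

/-- The product `∏_{i < n} (s - i) / (s + i + 1)`: the ratio of the `n`-th and the zeroth Fourier
coefficients of `x ↦ ‖1 + exp (2 * π * I * x)‖ ^ (2 * s)`. -/
noncomputable def fourierRatio (s : ℝ) (n : ℕ) : ℝ :=
  ∏ i ∈ range n, (s - i) / (s + i + 1)

lemma fourierRatio_succ (s : ℝ) (n : ℕ) :
    fourierRatio s (n + 1) = fourierRatio s n * ((s - n) / (s + n + 1)) :=
  prod_range_succ _ _

lemma fourierRatio_ne_zero {s : ℝ} (hs : 0 < s) (hsn : ∀ m : ℕ, s ≠ m) (n : ℕ) :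
    fourierRatio s n ≠ 0 :=
  prod_ne_zero_iff.2 fun i _ => div_ne_zero (sub_ne_zero.2 (hsn i)) (by positivity)

lemma summable_abs_fourierRatio {s : ℝ} (hs : 0 < s) :
    Summable fun n => |fourierRatio s n| := by
  obtain ⟨N, hN⟩ := exists_nat_ge s
  rw [← summable_nat_add_iff N]
  have hsum (k : ℕ) : 2 * s * ∑ i ∈ range k, |fourierRatio s (i + N)| =
      (N + s) * |fourierRatio s N| - (k + N + s) * |fourierRatio s (k + N)| := by
    induction k with
    | zero => simp
    | succ k ih =>
      have hk : s ≤ k + N := hN.trans (by simp)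
      rw [sum_range_succ, mul_add, ih, show k + 1 + N = k + N + 1 by ring, fourierRatio_succ,
        abs_mul, abs_div]
      push_cast
      rw [abs_of_nonpos (show s - (k + N) ≤ 0 by linarith),
        abs_of_pos (show 0 < s + (k + N) + 1 by positivity)]
      field_simp
      ring
  refine summable_of_sum_range_le (c := (N + s) * |fourierRatio s N| / (2 * s))
    (fun _ => abs_nonneg _) fun k => ?_
  rw [le_div_iff₀ (by positivity), mul_comm, hsum]
  have : 0 ≤ (k + N + s) * |fourierRatio s (k + N)| := by positivity
  linarith

lemma summable_abs_fourierRatio_natAbs {s : ℝ} (hs : 0 < s) :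
    Summable fun n : ℤ => |fourierRatio s n.natAbs| :=
  .of_nat_of_neg (by simpa using summable_abs_fourierRatio hs)
    (by simpa using summable_abs_fourierRatio hs)

lemma fourierRatio_mul_neg_one_pow_pos {s : ℝ} (hs : 0 < s) (hsn : ∀ m : ℕ, s ≠ m)
    {m n : ℕ} (hm : s < m) (hmn : m ≤ n) :
    0 < fourierRatio s m * fourierRatio s n * (-1) ^ (m + n) := by
  induction n, hmn using Nat.le_induction with
  | base =>
    rw [← two_mul, pow_mul, neg_one_sq, one_pow, mul_one]
    exact mul_self_pos.2 (fourierRatio_ne_zero hs hsn m)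
  | succ n hmn ih =>
    have hn : (m : ℝ) ≤ n := by exact_mod_cast hmn
    have h : 0 < (n - s) / (s + n + 1) := div_pos (by linarith) (by positivity)
    refine (mul_pos ih h).trans_eq ?_
    rw [fourierRatio_succ, ← add_assoc, pow_succ]
    ring

lemma fourierRatio_mul_neg {s : ℝ} (hs : 0 < s) (hsn : ∀ m : ℕ, s ≠ m)
    {m n : ℕ} (hm : s < m) (hmn : m ≤ n) (hodd : Odd (m + n)) :
    fourierRatio s m * fourierRatio s n < 0 := by
  have := fourierRatio_mul_neg_one_pow_pos hs hsn hm hmn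
  rw [hodd.neg_one_pow] at this
  linarith

/-- The continuous function `x ↦ ‖1 + exp (2 * π * I * x)‖ ^ p` on the circle. -/
noncomputable def normOneAddPow {p : ℝ} (hp : 0 < p) : C(UnitAddCircle, ℂ) where
  toFun x := ((‖1 + fourier 1 x‖ ^ p : ℝ) : ℂ)
  continuous_toFun := by
    refine Complex.continuous_ofReal.comp ?_
    exact Continuous.rpow_const (by fun_prop) fun _ => Or.inr hp.le

lemma normOneAddPow_coe {p : ℝ} (hp : 0 < p) (x : ℝ) :
    normOneAddPow hp (x : UnitAddCircle) =
      ((‖1 + Complex.exp (2 * Real.pi * Complex.I * x)‖ ^ p : ℝ) : ℂ) := by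
  have h : fourier 1 (x : UnitAddCircle) = Complex.exp (2 * Real.pi * Complex.I * x) := by
    rw [fourier_coe_apply]; simp
  simp [normOneAddPow, ← h, -fourier_apply]

lemma norm_one_add_exp (x : ℝ) (hx : 0 ≤ Real.cos (Real.pi * x)) :
    ‖1 + Complex.exp (2 * Real.pi * Complex.I * x)‖ = 2 * Real.cos (Real.pi * x) := by
  have h : 1 + Complex.exp (2 * Real.pi * Complex.I * x) =
      Complex.exp ((Real.pi * x : ℝ) * Complex.I) * (2 * Real.cos (Real.pi * x) : ℝ) := by
    push_cast
    rw [Complex.two_cos, mul_add, ← Complex.exp_add, ← Complex.exp_add]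
    ring_nf
    simp [add_comm]
  rw [h, norm_mul, Complex.norm_exp_ofReal_mul_I, one_mul, Complex.norm_real, Real.norm_eq_abs,
    abs_of_nonneg (by positivity)]

lemma cos_pi_mul_nonneg {x : ℝ} (hx : x ∈ Set.Icc (-1 / 2 : ℝ) (1 / 2)) :
    0 ≤ Real.cos (Real.pi * x) := by
  obtain ⟨h1, h2⟩ := hx
  exact Real.cos_nonneg_of_mem_Icc ⟨by nlinarith [Real.pi_pos], by nlinarith [Real.pi_pos]⟩

lemma fourierCoeff_normOneAddPow {p : ℝ} (hp : 0 < p) (n : ℤ) :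
    fourierCoeff (normOneAddPow hp) n =
      ∫ x in (-1 / 2 : ℝ)..(1 / 2), Complex.exp (-(2 * Real.pi * Complex.I * n * x)) *
        ((2 * Real.cos (Real.pi * x)) ^ p : ℝ) := by
  rw [fourierCoeff_eq_intervalIntegral _ n (-1 / 2), show (-1 / 2 + 1 : ℝ) = 1 / 2 by norm_num]
  simp only [div_one, one_smul]
  refine intervalIntegral.integral_congr fun x hx => ?_
  rw [Set.uIcc_of_le (by norm_num)] at hx
  simp only [normOneAddPow_coe, norm_one_add_exp x (cos_pi_mul_nonneg hx), fourier_coe_apply,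
    smul_eq_mul]
  congr 2
  push_cast
  ring

lemma fourierCoeff_normOneAddPow_succ {p : ℝ} (hp : 0 < p) (n : ℤ) :
    (p / 2 + n + 1 : ℂ) * fourierCoeff (normOneAddPow hp) (n + 1) =
      (p / 2 - n) * fourierCoeff (normOneAddPow hp) n := by
  let u : ℝ → ℝ := fun x => 2 * Real.cos (Real.pi * x)
  let A : ℤ → ℝ → ℂ := fun n x =>
    Complex.exp (-(2 * Real.pi * Complex.I * n * x)) * (u x ^ p : ℝ)
  have hA (n : ℤ) : Continuous (A n) := by
    refine Continuous.mul (by fun_prop) (Complex.continuous_ofReal.comp ?_)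
    exact Continuous.rpow_const (by fun_prop) fun _ => Or.inr hp.le
  have hderiv (x : ℝ) (hx : x ∈ Set.uIcc (-1 / 2 : ℝ) (1 / 2)) : HasDerivAt
      (fun x : ℝ => Complex.exp (-(Real.pi * Complex.I * (2 * n + 1) * x)) * (u x ^ (p + 1) : ℝ))
      (2 * Real.pi * Complex.I * ((p / 2 - n) * A n x - (p / 2 + n + 1) * A (n + 1) x)) x := by
    rw [Set.uIcc_of_le (by norm_num)] at hx
    have hu0 : 0 ≤ u x := mul_nonneg zero_le_two (cos_pi_mul_nonneg hx)
    have hu : HasDerivAt u (2 * (-Real.sin (Real.pi * x) * (Real.pi * 1))) x :=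
      (((hasDerivAt_id x).const_mul Real.pi).cos).const_mul 2
    have hup := (hu.rpow_const (p := p + 1) (Or.inr (by linarith))).ofReal_comp
    have he : HasDerivAt (fun x : ℝ => Complex.exp (-(Real.pi * Complex.I * (2 * n + 1) * x))) _ x :=
      (((hasDerivAt_id x).ofReal_comp.const_mul (Real.pi * Complex.I * (2 * n + 1))).neg).cexp
    refine (he.mul hup).congr_deriv ?_
    have hn : Complex.exp (-(2 * Real.pi * Complex.I * n * x)) =
        Complex.exp (-(Real.pi * Complex.I * (2 * n + 1) * x)) *
          (Complex.cos (Real.pi * x) + Complex.sin (Real.pi * x) * Complex.I) := by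
      rw [← Complex.exp_mul_I, ← Complex.exp_add]
      ring_nf
    have hn1 : Complex.exp (-(2 * Real.pi * Complex.I * (n + 1) * x)) =
        Complex.exp (-(Real.pi * Complex.I * (2 * n + 1) * x)) *
          (Complex.cos (Real.pi * x) - Complex.sin (Real.pi * x) * Complex.I) := by
      rw [Complex.cos_sub_sin_I, ← Complex.exp_add]
      ring_nf
    have hpow : u x ^ (p + 1) = u x ^ p * (2 * Real.cos (Real.pi * x)) := by
      rw [Real.rpow_add' hu0 (by linarith), Real.rpow_one]
    simp only [A, hpow, id, Pi.neg_apply, add_sub_cancel_right]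
    push_cast
    rw [hn, hn1]
    linear_combination (-2 * (p + 1) * Real.pi *
      Complex.exp (-(Real.pi * Complex.I * (2 * n + 1) * x)) * (u x ^ p : ℝ) *
      Complex.sin (Real.pi * x)) * Complex.I_sq
  have hint := intervalIntegral.integral_eq_sub_of_hasDerivAt hderiv
    (Continuous.intervalIntegrable (by fun_prop) _ _)
  have h1 : u (1 / 2) = 0 := by simp [u, ← div_eq_mul_inv]
  have h2 : u (-1 / 2) = 0 := by simp [u, neg_div, ← div_eq_mul_inv]
  rw [h1, h2, Real.zero_rpow (by linarith), intervalIntegral.integral_const_mul,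
    intervalIntegral.integral_sub (((hA _).const_mul _).intervalIntegrable _ _)
      (((hA _).const_mul _).intervalIntegrable _ _), intervalIntegral.integral_const_mul,
    intervalIntegral.integral_const_mul] at hint
  rw [fourierCoeff_normOneAddPow, fourierCoeff_normOneAddPow]
  have hpi : (2 * Real.pi * Complex.I : ℂ) ≠ 0 := Complex.two_pi_I_ne_zero
  refine (sub_eq_zero.1 ((mul_eq_zero.1 (hint.trans ?_)).resolve_left hpi)).symm
  simp

lemma zeroth_fourierCoeff_normOneAddPow {p : ℝ} (hp : 0 < p) :
    ∃ c : ℝ, 0 < c ∧ fourierCoeff (normOneAddPow hp) 0 = c := by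
  refine ⟨∫ x in (-1 / 2 : ℝ)..(1 / 2), (2 * Real.cos (Real.pi * x)) ^ p, ?_, ?_⟩
  · refine intervalIntegral.intervalIntegral_pos_of_pos_on ?_ (fun x hx => ?_) (by norm_num)
    · exact (Continuous.rpow_const (by fun_prop) fun _ => Or.inr hp.le).intervalIntegrable _ _
    · obtain ⟨h1, h2⟩ := hx
      have : 0 < Real.cos (Real.pi * x) :=
        Real.cos_pos_of_mem_Ioo ⟨by nlinarith [Real.pi_pos], by nlinarith [Real.pi_pos]⟩
      positivity
  · rw [fourierCoeff_normOneAddPow, ← intervalIntegral.integral_ofReal]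
    simp

lemma fourierCoeff_normOneAddPow_eq {p : ℝ} (hp : 0 < p) (n : ℤ) :
    fourierCoeff (normOneAddPow hp) n =
      fourierCoeff (normOneAddPow hp) 0 * fourierRatio (p / 2) n.natAbs := by
  have hplus (k : ℕ) : (p / 2 + k + 1 : ℂ) ≠ 0 := by
    have : p / 2 + k + 1 ≠ 0 := by positivity
    exact_mod_cast this
  have hpos (k : ℕ) : fourierCoeff (normOneAddPow hp) k =
      fourierCoeff (normOneAddPow hp) 0 * fourierRatio (p / 2) k := by
    induction k with
    | zero => simp [fourierRatio]
    | succ k ih =>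
      have h := fourierCoeff_normOneAddPow_succ hp k
      rw [ih] at h
      rw [fourierRatio_succ]
      push_cast at h ⊢
      refine mul_left_cancel₀ (hplus k) ?_
      linear_combination h - fourierCoeff (normOneAddPow hp) 0 * fourierRatio (p / 2) k *
        div_mul_cancel₀ (p / 2 - k : ℂ) (hplus k)
  have hneg (k : ℕ) : fourierCoeff (normOneAddPow hp) (-k) =
      fourierCoeff (normOneAddPow hp) 0 * fourierRatio (p / 2) k := by
    induction k with
    | zero => simp [fourierRatio]
    | succ k ih =>
      have h := fourierCoeff_normOneAddPow_succ hp (-(k + 1))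
      rw [show (-(k + 1) + 1 : ℤ) = -k by ring, ih] at h
      rw [fourierRatio_succ]
      push_cast at h ⊢
      refine mul_left_cancel₀ (hplus k) ?_
      linear_combination -h - fourierCoeff (normOneAddPow hp) 0 * fourierRatio (p / 2) k *
        div_mul_cancel₀ (p / 2 - k : ℂ) (hplus k)
  obtain ⟨k, rfl | rfl⟩ := n.eq_nat_or_neg
  · simpa using hpos k
  · simpa using hneg k

lemma hasSum_norm_one_add_exp_rpow {p : ℝ} (hp : 0 < p) :
    ∃ c : ℝ, 0 < c ∧ ∀ x : ℝ, HasSum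
      (fun n : ℤ => (c * fourierRatio (p / 2) n.natAbs : ℂ) *
        Complex.exp (2 * Real.pi * Complex.I * n * x))
      ((‖1 + Complex.exp (2 * Real.pi * Complex.I * x)‖ ^ p : ℝ) : ℂ) := by
  obtain ⟨c, hc, hc0⟩ := zeroth_fourierCoeff_normOneAddPow hp
  refine ⟨c, hc, fun x => ?_⟩
  have hcoeff (n : ℤ) : fourierCoeff (normOneAddPow hp) n =
      c * fourierRatio (p / 2) n.natAbs := by
    rw [fourierCoeff_normOneAddPow_eq hp, hc0]
  have hsum : Summable (fourierCoeff (normOneAddPow hp)) := by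
    refine .of_norm ?_
    simp only [hcoeff, norm_mul, Complex.norm_real, Real.norm_eq_abs]
    exact (summable_abs_fourierRatio_natAbs (by positivity)).mul_left _
  have := has_pointwise_sum_fourier_series_of_summable hsum (x : UnitAddCircle)
  simpa only [hcoeff, fourier_coe_apply, normOneAddPow_coe, smul_eq_mul, Complex.ofReal_one,
    div_one] using this

lemma intervalIntegral_exp_two_pi_I_int_mul (n : ℤ) :
    ∫ x in (0 : ℝ)..1, Complex.exp (2 * Real.pi * Complex.I * n * x) = if n = 0 then 1 else 0 := by
  split_ifs with hn
  · simp [hn]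
  · rw [integral_exp_mul_complex (by simp [hn])]
    have := Complex.exp_int_mul_two_pi_mul_I n
    rw [show (n * (2 * Real.pi * Complex.I) : ℂ) = 2 * Real.pi * Complex.I * n by ring] at this
    simp [this]

/-- Parseval formula for the product of dilates of two absolutely convergent Fourier series. -/
lemma hasSum_integral_mul_of_hasSum_exp {f g : ℝ → ℝ} {a b : ℤ → ℝ}
    (ha : Summable fun n => |a n|) (hb : Summable fun n => |b n|)
    (hf : ∀ x : ℝ, HasSum (fun n : ℤ => (a n : ℂ) * Complex.exp (2 * Real.pi * Complex.I * n * x))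
      (f x : ℂ))
    (hg : ∀ x : ℝ, HasSum (fun n : ℤ => (b n : ℂ) * Complex.exp (2 * Real.pi * Complex.I * n * x))
      (g x : ℂ)) (j k : ℤ) :
    HasSum (fun n : ℤ × ℤ => if j * n.1 + k * n.2 = 0 then a n.1 * b n.2 else 0)
      (∫ x in (0 : ℝ)..1, f (j * x) * g (k * x)) := by
  let F : ℤ × ℤ → ℝ → ℂ := fun n x =>
    (a n.1 * b n.2 : ℂ) * Complex.exp (2 * Real.pi * Complex.I * (j * n.1 + k * n.2 : ℤ) * x)
  have hF (n : ℤ × ℤ) : ∫ x in (0 : ℝ)..1, F n x =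
      ((if j * n.1 + k * n.2 = 0 then a n.1 * b n.2 else 0 : ℝ) : ℂ) := by
    rw [intervalIntegral.integral_const_mul, intervalIntegral_exp_two_pi_I_int_mul]
    split_ifs <;> simp
  have hnorm (n : ℤ × ℤ) (x : ℝ) : ‖F n x‖ = |a n.1| * |b n.2| := by
    have : (2 * Real.pi * Complex.I * (j * n.1 + k * n.2 : ℤ) * x : ℂ) =
        (2 * Real.pi * (j * n.1 + k * n.2 : ℤ) * x : ℝ) * Complex.I := by
      push_cast; ring
    simp only [F]
    rw [norm_mul, this, Complex.norm_exp_ofReal_mul_I, norm_mul, Complex.norm_real,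
      Complex.norm_real, mul_one, Real.norm_eq_abs, Real.norm_eq_abs]
  have hsum : Summable fun n : ℤ × ℤ => |a n.1| * |b n.2| :=
    ha.mul_of_nonneg hb (fun _ => abs_nonneg _) (fun _ => abs_nonneg _)
  have hlim (x : ℝ) : HasSum (fun n => F n x) ((f (j * x) * g (k * x) : ℝ) : ℂ) := by
    have hs : Summable fun n => F n x := .of_norm (by simpa only [hnorm] using hsum)
    have hFmul : (fun n => F n x) = fun n : ℤ × ℤ =>
        ((a n.1 : ℂ) * Complex.exp (2 * Real.pi * Complex.I * n.1 * (j * x : ℝ))) *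
        ((b n.2 : ℂ) * Complex.exp (2 * Real.pi * Complex.I * n.2 * (k * x : ℝ))) := by
      funext n
      rw [mul_mul_mul_comm, ← Complex.exp_add]
      simp only [F]
      push_cast
      ring_nf
    rw [hFmul] at hs ⊢
    rw [Complex.ofReal_mul (f _)]
    have h := (hf (j * x)).mul (hg (k * x)) hs
    exact h
  have key := intervalIntegral.hasSum_integral_of_dominated_convergence (μ := volume) (a := 0)
    (b := 1) (F := F) (f := fun x => ((f (j * x) * g (k * x) : ℝ) : ℂ))
    (fun n _ => |a n.1| * |b n.2|)
    (fun n => Continuous.aestronglyMeasurable (by fun_prop))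
    (fun n => .of_forall fun x _ => (hnorm n x).le)
    (.of_forall fun _ _ => hsum) intervalIntegrable_const (.of_forall fun x _ => hlim x)
  rw [intervalIntegral.integral_ofReal] at key
  simp only [hF] at key
  exact_mod_cast key

lemma integral_norm_rpow_lt {p : ℝ} (hp : 2 < p) (hpe : ∀ m : ℕ, p ≠ 2 * m)
    {j : ℤ} (hj : Odd j) (hjp : p / 2 < (j : ℝ)) :
    ∫ x in (0 : ℝ)..1, ‖1 + Complex.exp (2 * Real.pi * Complex.I * (j * x : ℝ))‖ ^ p *
        ‖1 + Complex.exp (2 * Real.pi * Complex.I * ((j + 1 : ℤ) * x : ℝ))‖ ^ p <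
      ∫ x in (0 : ℝ)..1, ‖1 + Complex.exp (2 * Real.pi * Complex.I * (j * x : ℝ))‖ ^ p *
        ‖1 - Complex.exp (2 * Real.pi * Complex.I * ((j + 1 : ℤ) * x : ℝ))‖ ^ p := by
  have hp0 : 0 < p := by linarith
  have hs : 0 < p / 2 := by linarith
  have hsn (m : ℕ) : p / 2 ≠ m := fun h => hpe m (by linarith)
  obtain ⟨c, hc, hsum⟩ := hasSum_norm_one_add_exp_rpow hp0
  let a : ℤ → ℝ := fun n => c * fourierRatio (p / 2) n.natAbs
  have ha : Summable fun n => |a n| := by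
    simp only [a, abs_mul]
    exact (summable_abs_fourierRatio_natAbs hs).mul_left _
  let b : ℤ → ℝ := fun n => (-1 : ℝ) ^ n * a n
  have hb : Summable fun n => |b n| := by
    simpa [b, abs_mul, abs_zpow] using ha
  have hf (x : ℝ) : HasSum
      (fun n : ℤ => (a n : ℂ) * Complex.exp (2 * Real.pi * Complex.I * n * x))
      ((‖1 + Complex.exp (2 * Real.pi * Complex.I * x)‖ ^ p : ℝ) : ℂ) := by
    simpa only [a, Complex.ofReal_mul] using hsum x
  have hg (x : ℝ) : HasSum
      (fun n : ℤ => (b n : ℂ) * Complex.exp (2 * Real.pi * Complex.I * n * x))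
      ((‖1 - Complex.exp (2 * Real.pi * Complex.I * x)‖ ^ p : ℝ) : ℂ) := by
    have h1 : Complex.exp (2 * Real.pi * Complex.I * (x + 1 / 2 : ℝ)) =
        -Complex.exp (2 * Real.pi * Complex.I * x) := by
      rw [← Complex.exp_add_pi_mul_I]
      push_cast
      ring_nf
    have h2 (n : ℤ) : Complex.exp (2 * Real.pi * Complex.I * n * (x + 1 / 2 : ℝ)) =
        (-1) ^ n * Complex.exp (2 * Real.pi * Complex.I * n * x) := by
      rw [← Complex.exp_pi_mul_I, ← Complex.exp_int_mul, ← Complex.exp_add]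
      push_cast
      ring_nf
    have := hf (x + 1 / 2)
    rw [h1, ← sub_eq_add_neg] at this
    convert this using 2 with n
    simp only [h2, b]
    push_cast
    ring
  have hj0 : 0 < j := by
    have : (0 : ℝ) < j := by linarith
    exact_mod_cast this
  lift j to ℕ using hj0.le
  have hjp' : p / 2 < (j : ℕ) := by exact_mod_cast hjp
  have hneg (m n : ℤ) (hn : Odd n) (h : (j : ℤ) * m + ((j : ℤ) + 1) * n = 0) : a m * a n < 0 := by
    obtain ⟨k, hk⟩ : ∃ k, k = m + n := ⟨_, rfl⟩
    obtain rfl : n = -(j * k) := by rw [hk]; linear_combination h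
    obtain rfl : m = (j + 1) * k := by linear_combination -hk
    have hkodd : Odd k := (Int.odd_mul.1 (odd_neg.1 hn)).2
    have hk1 : 1 ≤ k.natAbs := Int.natAbs_pos.2 fun h0 => by simp [h0] at hkodd
    have hodd : Odd (j * k.natAbs + (j + 1) * k.natAbs) := by
      rw [← add_mul]
      exact Odd.mul ⟨j, by ring⟩ (Int.natAbs_odd.2 hkodd)
    have hjk : (j : ℝ) ≤ (j * k.natAbs : ℕ) := by
      exact_mod_cast Nat.le_mul_of_pos_right j hk1
    have := fourierRatio_mul_neg hs hsn (hjp'.trans_le hjk) (by gcongr; simp) hodd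
    have hm : ((j + 1 : ℤ) * k).natAbs = (j + 1) * k.natAbs := by
      rw [Int.natAbs_mul]; rfl
    simp only [a, Int.natAbs_neg, hm, Int.natAbs_mul, Int.natAbs_natCast]
    nlinarith [mul_pos hc hc]
  have hG := hasSum_integral_mul_of_hasSum_exp ha ha hf hf j (j + 1)
  have hg := hasSum_integral_mul_of_hasSum_exp ha hb hf hg j (j + 1)
  refine hasSum_lt (i := ((j + 1 : ℤ), (-j : ℤ))) (fun n => ?_) ?_ hG hg
  · dsimp only
    split_ifs with h
    · obtain hn | hn := Int.even_or_odd n.2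
      · simp [b, hn.neg_one_zpow]
      · have := hneg n.1 n.2 hn h
        simp only [b, hn.neg_one_zpow]
        linarith
    · rfl
  · have h : (j : ℤ) * (j + 1) + ((j : ℤ) + 1) * -j = 0 := by ring
    have := hneg (j + 1) (-j) hj.neg h
    simp only [h, if_true, b, hj.neg.neg_one_zpow]
    linarith

/-- By continuity, the Mockenhaupt–Schlag majorant counterexample persists when
the right-hand exponent is lowered: for `p > 2` not an even integer and `j` odd
with `j > p/2`, with `G₀ = (1+e_j)(1+e_{j+1})` and `g₀ = (1+e_j)(1−e_{j+1})`,
there is `q(p) < p` such that `‖G₀‖_{L^p} < ‖g₀‖_{L^q}` for all `q(p) < q ≤ p`. -/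
theorem majorant_fails_lower_exponent
    (p : ℝ) (hp : 2 < p) (hpe : ∀ m : ℕ, p ≠ 2 * m)
    (j : ℤ) (hj : Odd j) (hjp : p / 2 < (j : ℝ))
    (G₀ g₀ : ℝ → ℂ)
    (hG₀ : ∀ x : ℝ, G₀ x =
      (1 + Complex.exp (2 * Real.pi * Complex.I * (j : ℂ) * (x : ℂ))) *
        (1 + Complex.exp (2 * Real.pi * Complex.I * ((j : ℂ) + 1) * (x : ℂ))))
    (hg₀ : ∀ x : ℝ, g₀ x =
      (1 + Complex.exp (2 * Real.pi * Complex.I * (j : ℂ) * (x : ℂ))) *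
        (1 - Complex.exp (2 * Real.pi * Complex.I * ((j : ℂ) + 1) * (x : ℂ)))) :
    ∃ q₀ : ℝ, q₀ < p ∧
      ∀ q : ℝ, q₀ < q → q ≤ p →
        (∫ x in (0 : ℝ)..1, ‖G₀ x‖ ^ p) ^ (1 / p) <
          (∫ x in (0 : ℝ)..1, ‖g₀ x‖ ^ q) ^ (1 / q) := by
  have hlt : ∫ x in (0 : ℝ)..1, ‖G₀ x‖ ^ p < ∫ x in (0 : ℝ)..1, ‖g₀ x‖ ^ p := by
    convert integral_norm_rpow_lt hp hpe hj hjp using 4 with x x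
    all_goals
      simp only [hG₀, hg₀]
      rw [norm_mul, Real.mul_rpow (norm_nonneg _) (norm_nonneg _)]
      push_cast
      simp only [mul_assoc]
  have hG : 0 ≤ ∫ x in (0 : ℝ)..1, ‖G₀ x‖ ^ p :=
    intervalIntegral.integral_nonneg zero_le_one fun x _ => by positivity
  have hcont : Continuous fun q : ℝ => ∫ x in (0 : ℝ)..1, ‖g₀ x‖ ^ max q 1 := by
    refine intervalIntegral.continuous_parametric_intervalIntegral_of_continuous' ?_ 0 1
    have hg : Continuous g₀ := by
      rw [funext hg₀]
      fun_prop
    exact Continuous.rpow (by fun_prop) (by fun_prop)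
      fun x => Or.inr (lt_max_of_lt_right one_pos)
  have hcont' : ContinuousAt
      (fun q : ℝ => (∫ x in (0 : ℝ)..1, ‖g₀ x‖ ^ max q 1) ^ (1 / q)) p :=
    hcont.continuousAt.rpow (continuousAt_const.div continuousAt_id (by positivity))
      (Or.inr (by positivity))
  have hp1 : max p 1 = p := max_eq_left (by linarith)
  have hev := hcont'.eventually_const_lt (u := (∫ x in (0 : ℝ)..1, ‖G₀ x‖ ^ p) ^ (1 / p))
    (by simpa only [hp1] using Real.rpow_lt_rpow hG hlt (by positivity))
  obtain ⟨ε, hε, hball⟩ := Metric.eventually_nhds_iff.1 hev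
  refine ⟨max (p - ε) 1, max_lt (by linarith) (by linarith), fun q hq hqp => ?_⟩
  obtain ⟨hq1, hq2⟩ := max_lt_iff.1 hq
  have := hball (y := q) (by rw [Real.dist_eq, abs_lt]; constructor <;> linarith)
  rwa [max_eq_left hq2.le] at this
end
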